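/- arXiv:2411.04601 — 3 statements merged into one kernel-verified Lean document; each statement's English description precedes it below -/
import Mathlib

section
/- Let G be a graph (possibly a multigraph) and e an edge of G. Let G ∪ {x} be the multigraph obtained by adding a new edge x parallel to e (same endpoints). Then M(G ∪ {x}) is homotopy equivalent to the wedge of M(G) and the suspension of M(G \ EN_G[e]). -/
noncomputable section

/-- The geometric realization of a set of faces `K` (an abstract simplicial complex):
the space of convex-combination weight functions supported on a face. -/
def realization {α : Type*} (K : Set (Finset α)) : Type _ :=
  {f : α → ℝ // (∀ a, 0 ≤ f a) ∧ ∃ s ∈ K, Function.support f ⊆ ↑s ∧ ∑ a ∈ s, f a = 1}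

instance realization.topologicalSpace {α : Type*} (K : Set (Finset α)) :
    TopologicalSpace (realization K) :=
  instTopologicalSpaceSubtype

/-- The unreduced suspension of a space: the cylinder `X × [0,1]` together with two cone
points, gluing `X × {0}` to one and `X × {1}` to the other.  (With this definition, the
suspension of the empty space is the two-point space `S⁰`.) -/
def Susp (X : Type*) [TopologicalSpace X] : Type _ :=
  Quot (fun (p q : (X × Set.Icc (0:ℝ) 1) ⊕ Bool) =>
    match p, q with
    | Sum.inl p, Sum.inr b => ((p.2 : ℝ) = 0 ∧ b = false) ∨ ((p.2 : ℝ) = 1 ∧ b = true)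
    | _, _ => False)

instance Susp.topologicalSpace (X : Type*) [TopologicalSpace X] :
    TopologicalSpace (Susp X) := by
  unfold Susp; infer_instance

/-- The wedge sum of two pointed spaces. -/
def Wedge (X : Type*) (Y : Type*) [TopologicalSpace X] [TopologicalSpace Y]
    (x : X) (y : Y) : Type _ :=
  Quot (fun (a b : X ⊕ Y) => a = Sum.inl x ∧ b = Sum.inr y)

instance Wedge.topologicalSpace (X : Type*) (Y : Type*) [TopologicalSpace X]
    [TopologicalSpace Y] (x : X) (y : Y) : TopologicalSpace (Wedge X Y x y) := by
  unfold Wedge; infer_instance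

/-- The `n`-sphere, as the unit sphere in `ℝ^(n+1)`. -/
def nSphere (n : ℕ) : Type :=
  Metric.sphere (0 : EuclideanSpace ℝ (Fin (n + 1))) 1

instance nSphere.topologicalSpace (n : ℕ) : TopologicalSpace (nSphere n) := by
  unfold nSphere; infer_instance

/-- A basepoint on the `n`-sphere. -/
def spherePt (n : ℕ) : nSphere n :=
  ⟨EuclideanSpace.single 0 1, by simp [EuclideanSpace.norm_single]⟩

/-- The wedge of a family of spheres, of dimensions `n i`. -/
def WedgeOfSpheres {ι : Type} (n : ι → ℕ) : Type :=
  Quot (fun (a b : Σ i, nSphere (n i)) =>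
    ∃ i j, a = ⟨i, spherePt (n i)⟩ ∧ b = ⟨j, spherePt (n j)⟩)

instance WedgeOfSpheres.topologicalSpace {ι : Type} (n : ι → ℕ) :
    TopologicalSpace (WedgeOfSpheres n) := by
  unfold WedgeOfSpheres; infer_instance

/-- A space is (homotopy equivalent to) a wedge of spheres if it is homotopy equivalent to a
wedge of finitely many spheres of possibly varying dimensions. -/
def IsWedgeOfSpheres (X : Type*) [TopologicalSpace X] : Prop :=
  ∃ (k : ℕ) (n : Fin k → ℕ), Nonempty (ContinuousMap.HomotopyEquiv X (WedgeOfSpheres n))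
/-- The matching complex of a simple graph: faces are finite sets of pairwise disjoint edges. -/
def matchingComplex {V : Type*} (G : SimpleGraph V) : Set (Finset (Sym2 V)) :=
  {s | (∀ e ∈ s, e ∈ G.edgeSet) ∧ ∀ e ∈ s, ∀ f ∈ s, e ≠ f → ∀ v, v ∈ e → v ∉ f}

/-- The open edge neighborhood `EN(e)`: the set of edges of `G` adjacent to (sharing a vertex
with) `e`, other than `e` itself. -/
def edgeNbhdOpen {V : Type*} (G : SimpleGraph V) (e : Sym2 V) : Set (Sym2 V) :=
  {f | f ∈ G.edgeSet ∧ f ≠ e ∧ ∃ v, v ∈ e ∧ v ∈ f}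

/-- The closed edge neighborhood `EN[e]`: the set of edges of `G` sharing a vertex with `e`,
together with `e` itself. -/
def edgeNbhdClosed {V : Type*} (G : SimpleGraph V) (e : Sym2 V) : Set (Sym2 V) :=
  {f | f ∈ G.edgeSet ∧ ∃ v, v ∈ e ∧ v ∈ f}

/-- Two chords of a circle, with endpoints at circle positions `a, b` and `c, d`
(positions measured injectively along the circle), cross iff their endpoints interleave. -/
def chordsCross (a b c d : ℝ) : Prop :=
  (min a b < min c d ∧ min c d < max a b ∧ max a b < max c d) ∨
  (min c d < min a b ∧ min a b < max c d ∧ max c d < max a b)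

/-- A graph is outerplanar iff it has a drawing with all vertices (injectively) on a circle
and edges drawn as pairwise noncrossing chords; equivalently, a planar drawing with every
vertex on the unbounded face. -/
def Outerplanar {V : Type*} (G : SimpleGraph V) : Prop :=
  ∃ f : V ↪ ℝ, ∀ a b c d, G.Adj a b → G.Adj c d →
    a ≠ c → a ≠ d → b ≠ c → b ≠ d → ¬ chordsCross (f a) (f b) (f c) (f d)

/-- An outerplanar graph is maximal outerplanar if adding any edge destroys outerplanarity. -/
def MaximalOuterplanar {V : Type*} (G : SimpleGraph V) : Prop :=
  Outerplanar G ∧ ∀ a b : V, a ≠ b → ¬ G.Adj a b →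
    ¬ Outerplanar (G ⊔ SimpleGraph.fromEdgeSet {s(a, b)})
/-- A cutpoint (cut-vertex) of a graph: a vertex whose removal disconnects two vertices that
were connected, i.e. whose removal increases the number of connected components. -/
def IsCutvertex {V : Type*} (G : SimpleGraph V) (v : V) : Prop :=
  ∃ a b : {u : V // u ≠ v}, G.Reachable a.1 b.1 ∧
    ¬ (G.induce {u : V | u ≠ v}).Reachable ⟨a.1, a.2⟩ ⟨b.1, b.2⟩

/-- A block of `G`: a maximal connected subgraph having no cutpoint of itself. -/
def IsBlock {V : Type*} (G : SimpleGraph V) (H : G.Subgraph) : Prop :=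
  H.Connected ∧ (∀ v, ¬ IsCutvertex H.coe v) ∧
    ∀ H' : G.Subgraph, H ≤ H' → H'.Connected → (∀ v, ¬ IsCutvertex H'.coe v) → H' = H

/-- The block-cutpoint graph of `G`: the bipartite graph on blocks and cutpoints of `G`,
with a block `B` adjacent to a cutpoint `c` iff `c` belongs to `B`. -/
def blockCutpointGraph {V : Type*} (G : SimpleGraph V) :
    SimpleGraph ({H : G.Subgraph // IsBlock G H} ⊕ {v : V // IsCutvertex G v}) :=
  SimpleGraph.fromRel (fun x y =>
    ∃ B c, x = Sum.inl B ∧ y = Sum.inr c ∧ c.1 ∈ B.1.verts)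

/-- A cycle (given as a closed walk) is chordless if every edge of `G` joining two of its
vertices is an edge of the cycle.  In an outerplanar graph drawn with all vertices on the
unbounded face, the basic cycles (boundaries of the bounded faces) are exactly the
chordless cycles. -/
def Chordless {V : Type*} (G : SimpleGraph V) {v : V} (p : G.Walk v v) : Prop :=
  ∀ a ∈ p.support, ∀ b ∈ p.support, G.Adj a b → s(a, b) ∈ p.edges

/-- The basic cycles of (an outerplanar graph) `G`, recorded by their edge sets. -/
def basicCycles {V : Type*} [DecidableEq V] (G : SimpleGraph V) : Set (Finset (Sym2 V)) :=
  {s | ∃ (v : V) (p : G.Walk v v), p.IsCycle ∧ Chordless G p ∧ s = p.edges.toFinset}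

/-- The weak dual of (an outerplanar graph) `G`: vertices are the basic cycles (bounded
faces), two being adjacent iff they share at least one edge. -/
def weakDual {V : Type*} [DecidableEq V] (G : SimpleGraph V) :
    SimpleGraph (basicCycles G) :=
  SimpleGraph.fromRel (fun s t => ((s.1 ∩ t.1) : Finset (Sym2 V)).Nonempty)

/-- A multigraph on vertex set `V`: an edge index type together with an assignment of
(unordered pairs of) endpoints. -/
structure Multigraph (V : Type u) : Type (max u (v + 1)) where
  E : Type v
  ends : E → Sym2 V

/-- The matching complex of a multigraph: faces are finite sets of pairwise
vertex-disjoint edges. -/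
def Multigraph.matchingComplex {V : Type*} (M : Multigraph V) : Set (Finset M.E) :=
  {s | ∀ i ∈ s, ∀ j ∈ s, i ≠ j → ∀ v, v ∈ M.ends i → v ∉ M.ends j}
/-- The complex of finite sets whose distinct elements are pairwise related. -/
def cpx {β : Type*} (d : β → β → Prop) : Set (Finset β) :=
  {s | ∀ i ∈ s, ∀ j ∈ s, i ≠ j → d i j}

/-- The barycentric coordinates of a point. -/
def co {β : Type*} {K : Set (Finset β)} (f : realization K) : β → ℝ := f.1

section basics
variable {β : Type*} {d : β → β → Prop}

theorem rl_nonneg (f : realization (cpx d)) (i : β) : 0 ≤ (co f) i := f.2.1 i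

theorem rl_pair (f : realization (cpx d)) {i j : β} (hi : (co f) i ≠ 0) (hj : (co f) j ≠ 0)
    (h : i ≠ j) : d i j := by
  obtain ⟨s, hs, hsup, _⟩ := f.2.2
  exact hs i (hsup hi) j (hsup hj) h

theorem rl_fin (f : realization (cpx d)) : (Function.support (co f)).Finite := by
  obtain ⟨s, hs, hsup, _⟩ := f.2.2
  exact s.finite_toSet.subset hsup

theorem rl_sum (f : realization (cpx d)) : HasSum (co f) 1 := by
  obtain ⟨s, hs, hsup, h⟩ := f.2.2
  have h' : ∑ a ∈ s, co f a = 1 := h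
  rw [← h']
  apply hasSum_sum_of_ne_finset_zero
  intro b hb
  by_contra hne
  exact hb (hsup hne)

theorem rl_le_one (f : realization (cpx d)) (i : β) : (co f) i ≤ 1 :=
  le_hasSum (rl_sum f) i (fun j _ => rl_nonneg f j)

/-- Constructor for points of the realization. -/
def rlMk (w : β → ℝ) (h0 : ∀ i, 0 ≤ w i) (hf : (Function.support w).Finite)
    (hp : ∀ i j, w i ≠ 0 → w j ≠ 0 → i ≠ j → d i j) (hs : HasSum w 1) : realization (cpx d) :=
  ⟨w, h0, hf.toFinset, fun i hi j hj h => hp i j (by simpa using hi) (by simpa using hj) h,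
    by simp, by
      rw [← hs.tsum_eq]
      exact (tsum_eq_sum (fun b hb => by simpa using hb)).symm⟩

@[simp] theorem co_rlMk (w : β → ℝ) (h0 hf) (hp : ∀ i j, w i ≠ 0 → w j ≠ 0 → i ≠ j → d i j)
    (hs) (i : β) : co (rlMk w h0 hf hp hs) i = w i := rfl

theorem rl_ext {f g : realization (cpx d)} (h : ∀ i, (co f) i = (co g) i) : f = g :=
  Subtype.ext (funext h)

theorem rl_cont {Y : Type*} [TopologicalSpace Y] {F : Y → realization (cpx d)}
    (h : ∀ i, Continuous fun y => co (F y) i) : Continuous F :=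
  Continuous.subtype_mk (continuous_pi h) fun y => (F y).2

theorem rl_coord (i : β) : Continuous fun f : realization (cpx d) => (co f) i :=
  (continuous_apply i).comp continuous_subtype_val

open Classical in
theorem rl_vertex (f : realization (cpx d)) {i : β} (h : (co f) i = 1) {j : β} (hj : j ≠ i) :
    (co f) j = 0 := by
  have h1 := sum_le_hasSum ({i, j} : Finset β) (fun k _ => rl_nonneg f k) (rl_sum f)
  rw [Finset.sum_pair hj.symm] at h1
  have := rl_nonneg f j
  linarith

end basics

theorem hasSum_opt {β : Type*} {w : β → ℝ} {a : ℝ} (b : ℝ) (h : HasSum w a) :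
    HasSum (fun o : Option β => o.elim b w) (b + a) := by
  rw [← (Equiv.optionEquivSumPUnit.{0} β).symm.hasSum_iff, add_comm]
  apply HasSum.sum
  · simpa [Function.comp_def] using h
  · simpa [Function.comp_def] using hasSum_unique (fun _ : PUnit => b)

theorem hasSum_opt_inv {β : Type*} {w : Option β → ℝ} {a : ℝ} (h : HasSum w a) :
    HasSum (fun i => w (some i)) (a - w none) := by
  have h1 : Summable (fun i => w (some i)) := h.summable.comp_injective (Option.some_injective β)
  have h2 := hasSum_opt (w none) h1.hasSum
  have h3 : (fun o : Option β => o.elim (w none) (fun i => w (some i))) = w := by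
    funext o; cases o <;> rfl
  rw [h3] at h2
  have := h.unique h2
  rw [this, add_sub_cancel_left]
  exact h1.hasSum

theorem opt_fin {β : Type*} {w : Option β → ℝ}
    (h : (Function.support fun i => w (some i)).Finite) : (Function.support w).Finite := by
  refine ((h.image some).insert none).subset ?_
  rintro (_ | i) hi
  · simp
  · exact Or.inr ⟨i, hi, rfl⟩

/-- The data of a symmetric relation with a chosen non-reflexive element. -/
structure PS (α : Type*) where
  d : α → α → Prop
  e : α
  symm : ∀ i j, d i j → d j i
  irr : ¬ d e e

namespace PS
open Classical
variable {α : Type*} (S : PS α)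

abbrev dA (i j : Option α) : Prop := S.d (i.getD S.e) (j.getD S.e)
abbrev dL (i j : {i // S.d S.e i}) : Prop := S.d i.1 j.1
abbrev X := realization (cpx S.d)
abbrev A := realization (cpx S.dA)
abbrev L := realization (cpx S.dL)

variable {S}

/-- Extension by zero. -/
def ext (l : S.L) (i : α) : ℝ := if h : S.d S.e i then (co l) ⟨i, h⟩ else 0

theorem ext_sum (l : S.L) : HasSum (ext l) 1 := by
  have h := rl_sum l
  have : (fun i : {i // S.d S.e i} => ext l i.1) = (co l) := by
    funext i; simp [ext, i.2]
  rw [← this] at h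
  refine (hasSum_subtype_iff_of_support_subset (s := {i | S.d S.e i}) ?_).1 h
  intro i hi
  by_contra hn
  exact hi (by simpa [ext] using fun h => absurd h hn)

theorem ext_nonneg (l : S.L) (i : α) : 0 ≤ ext l i := by
  unfold ext; split_ifs
  · exact rl_nonneg _ _
  · exact le_rfl

theorem ext_ne {l : S.L} {i : α} (h : ext l i ≠ 0) : ∃ hi : S.d S.e i, (co l) ⟨i, hi⟩ ≠ 0 := by
  unfold ext at h
  split_ifs at h with hi
  · exact ⟨hi, h⟩
  · exact absurd rfl h

theorem ext_pair {l : S.L} {i j : α} (hi : ext l i ≠ 0) (hj : ext l j ≠ 0) (h : i ≠ j) :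
    S.d i j := by
  obtain ⟨_, h1⟩ := ext_ne hi
  obtain ⟨_, h2⟩ := ext_ne hj
  exact rl_pair l h1 h2 (by simpa using h)

theorem ext_d {l : S.L} {i : α} (hi : ext l i ≠ 0) : S.d S.e i := (ext_ne hi).1

theorem ext_fin (l : S.L) : (Function.support (ext l)).Finite := by
  refine ((rl_fin l).image Subtype.val).subset ?_
  intro i hi
  obtain ⟨h1, h2⟩ := ext_ne hi
  exact ⟨⟨i, h1⟩, h2, rfl⟩

theorem ext_cont (i : α) : Continuous fun l : S.L => ext l i := by
  unfold ext
  by_cases h : S.d S.e i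
  · simpa [h] using rl_coord _
  · simpa [h] using continuous_const

theorem A_d {f : S.A} (h : (co f) none ≠ 0) {i : α} (hi : (co f) (some i) ≠ 0) : S.d S.e i :=
  rl_pair f h hi (by simp)

theorem A_e {f : S.A} (h : (co f) none ≠ 0) : (co f) (some S.e) = 0 := by
  by_contra hn
  exact S.irr (A_d h hn)

theorem A_pair {f : S.A} {i j : α} (hi : (co f) (some i) ≠ 0) (hj : (co f) (some j) ≠ 0) (h : i ≠ j) :
    S.d i j := rl_pair f hi hj (by simpa using h)

theorem A_fin (f : S.A) : (Function.support fun i => (co f) (some i)).Finite :=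
  (rl_fin f).preimage ((Option.some_injective α).injOn)

theorem fin_add {w : α → ℝ} (h : (Function.support w).Finite) (e : α) (c b : ℝ) :
    (Function.support fun i => c * w i + if i = e then b else 0).Finite := by
  refine (h.insert e).subset ?_
  intro i hi
  by_cases hie : i = e
  · exact Or.inl hie
  · right
    intro h0
    exact hi (by simp [hie, h0])

theorem sum_add {w : α → ℝ} {a : ℝ} (h : HasSum w a) (e : α) (c b : ℝ) :
    HasSum (fun i => c * w i + if i = e then b else 0) (c * a + b) :=
  (h.mul_left c).add (hasSum_ite_eq e b)

/-- The points of `A` obtained by moving along the suspension coordinate. -/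
def P (f : S.A) (u c : ℝ) (hc : 0 ≤ c) (h : c * (1 - (co f) none) = 1 - |u|)
    (hu : (co f) none = 0 → u = 0) : S.A :=
  rlMk (fun o => o.elim (max u 0) (fun i => c * (co f) (some i) + if i = S.e then max (-u) 0 else 0))
    (by
      rintro (_ | i)
      · exact le_max_right _ _
      · have := rl_nonneg f (some i)
        simp only [Option.elim]
        split_ifs <;> positivity)
    (opt_fin (fin_add (A_fin f) _ _ _))
    (by
      have key : ∀ i, (c * (co f) (some i) + if i = S.e then max (-u) 0 else 0) ≠ 0 →
          (co f) (some i) ≠ 0 ∨ (i = S.e ∧ u < 0) := by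
        intro i hi
        by_contra! hcon
        apply hi
        rw [hcon.1]
        split_ifs with h1
        · simp [hcon.2 h1]
        · simp
      rintro (_ | i) (_ | j) hi hj hij
      · exact absurd rfl hij
      · simp only [Option.elim] at hi hj
        have hu0 : 0 < u := by
          by_contra! hh
          exact hi (max_eq_right hh)
        rcases key j hj with h1 | h1
        · exact A_d (fun h0 => hu0.ne' (hu h0)) h1
        · linarith [h1.2]
      · simp only [Option.elim] at hi hj
        have hu0 : 0 < u := by
          by_contra! hh
          exact hj (max_eq_right hh)
        rcases key i hi with h1 | h1
        · exact S.symm _ _ (A_d (fun h0 => hu0.ne' (hu h0)) h1)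
        · linarith [h1.2]
      · simp only [Option.elim] at hi hj
        have hij' : i ≠ j := by simpa using hij
        rcases key i hi with h1 | h1 <;> rcases key j hj with h2 | h2
        · exact A_pair h1 h2 hij'
        · obtain ⟨rfl, hlt⟩ := h2
          exact S.symm _ _ (A_d (fun h0 => hlt.ne (hu h0)) h1)
        · obtain ⟨rfl, hlt⟩ := h1
          exact A_d (fun h0 => hlt.ne (hu h0)) h2
        · exact absurd (h1.1.trans h2.1.symm) hij')
    (by
      have h1 := hasSum_opt (max u 0) (sum_add (hasSum_opt_inv (rl_sum f)) S.e c (max (-u) 0))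
      rw [h] at h1
      convert h1 using 1
      rcases le_total 0 u with h2 | h2
      · rw [abs_of_nonneg h2, max_eq_left h2, max_eq_right (by linarith)]; ring
      · rw [abs_of_nonpos h2, max_eq_right h2, max_eq_left (by linarith)]; ring)

/-- Inclusion of `X` in `A`. -/
def emb (f : S.X) : S.A :=
  rlMk (fun o => o.elim 0 (co f))
    (by rintro (_ | i); exacts [le_rfl, rl_nonneg f i])
    (opt_fin (rl_fin f))
    (by
      rintro (_ | i) (_ | j) hi hj hij
      · exact absurd rfl hij
      · exact absurd rfl hi
      · exact absurd rfl hj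
      · exact rl_pair f hi hj (by simpa using hij))
    (by simpa using hasSum_opt 0 (rl_sum f))

/-- The segment from a point of the link to the vertex `e`. -/
def RX (l : S.L) (v : Set.Icc (0:ℝ) 1) : S.X :=
  rlMk (fun i => (1 - v.1) * ext l i + if i = S.e then v.1 else 0)
    (by
      intro i
      have h1 := ext_nonneg l i
      have h2 := v.2.1
      have h3 : 0 ≤ 1 - v.1 := by linarith [v.2.2]
      split_ifs <;> positivity)
    (fin_add (ext_fin l) _ _ _)
    (by
      have key : ∀ i, ((1 - v.1) * ext l i + if i = S.e then v.1 else 0) ≠ 0 →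
          ext l i ≠ 0 ∨ i = S.e := by
        intro i hi
        by_contra! hcon
        apply hi
        simp [hcon.1, hcon.2]
      intro i j hi hj hij
      rcases key i hi with h1 | h1 <;> rcases key j hj with h2 | h2
      · exact ext_pair h1 h2 hij
      · subst h2; exact S.symm _ _ (ext_d h1)
      · subst h1; exact ext_d h2
      · exact absurd (h1.trans h2.symm) hij)
    (by simpa using sum_add (ext_sum l) S.e (1 - v.1) v.1)

/-- The suspension of the link inside `A`. -/
def R (l : S.L) (u : Set.Icc (-1:ℝ) 1) : S.A :=
  rlMk (fun o => o.elim (max u.1 0)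
      (fun i => (1 - |u.1|) * ext l i + if i = S.e then max (-u.1) 0 else 0))
    (by
      rintro (_ | i)
      · exact le_max_right _ _
      · have h1 := ext_nonneg l i
        have h3 : 0 ≤ 1 - |u.1| := by linarith [abs_le.2 u.2]
        simp only [Option.elim]
        split_ifs <;> positivity)
    (opt_fin (fin_add (ext_fin l) _ _ _))
    (by
      have key : ∀ i, ((1 - |u.1|) * ext l i + if i = S.e then max (-u.1) 0 else 0) ≠ 0 →
          ext l i ≠ 0 ∨ (i = S.e ∧ u.1 < 0) := by
        intro i hi
        by_contra! hcon
        apply hi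
        rw [hcon.1]
        split_ifs with h1
        · simp [hcon.2 h1]
        · simp
      rintro (_ | i) (_ | j) hi hj hij
      · exact absurd rfl hij
      · simp only [Option.elim] at hi hj
        rcases key j hj with h1 | h1
        · exact ext_d h1
        · exact absurd (max_eq_right h1.2.le) hi
      · simp only [Option.elim] at hi hj
        rcases key i hi with h1 | h1
        · exact S.symm _ _ (ext_d h1)
        · exact absurd (max_eq_right h1.2.le) hj
      · simp only [Option.elim] at hi hj
        have hij' : i ≠ j := by simpa using hij
        rcases key i hi with h1 | h1 <;> rcases key j hj with h2 | h2
        · exact ext_pair h1 h2 hij'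
        · obtain ⟨rfl, hlt⟩ := h2
          exact S.symm _ _ (ext_d h1)
        · obtain ⟨rfl, hlt⟩ := h1
          exact ext_d h2
        · exact absurd (h1.1.trans h2.1.symm) hij')
    (by
      have h1 := hasSum_opt (max u.1 0) (sum_add (ext_sum l) S.e (1 - |u.1|) (max (-u.1) 0))
      convert h1 using 1
      rcases le_total 0 u.1 with h2 | h2
      · rw [abs_of_nonneg h2, max_eq_left h2, max_eq_right (by linarith)]; ring
      · rw [abs_of_nonpos h2, max_eq_right h2, max_eq_left (by linarith)]; ring)

/-- The vertex `e`. -/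
def eX : S.X :=
  rlMk (fun i => if i = S.e then 1 else 0)
    (by intro i; split_ifs <;> norm_num)
    ((Set.finite_singleton S.e).subset (by intro i hi; by_contra h; exact hi (if_neg h)))
    (by
      intro i j hi hj hij
      have h1 : i = S.e := by by_contra h; exact hi (if_neg h)
      have h2 : j = S.e := by by_contra h; exact hj (if_neg h)
      exact absurd (h1.trans h2.symm) hij)
    (hasSum_ite_eq S.e 1)

/-- The new vertex. -/
def nA : S.A :=
  rlMk (fun o => o.elim 1 (fun _ => 0))
    (by rintro (_ | i) <;> simp)
    (opt_fin (by simp))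
    (by
      rintro (_ | i) (_ | j) hi hj hij
      · exact absurd rfl hij
      · exact absurd rfl hj
      · exact absurd rfl hi
      · exact absurd rfl hi)
    (by simpa using hasSum_opt 1 (hasSum_zero (α := ℝ) (β := α)))

/-- The retraction-like map to `X`. -/
def g (f : S.A) : S.X :=
  rlMk (fun i => (max (1 - 2 * (co f) none) 0 / max (1 - (co f) none) (1/2)) * (co f) (some i) +
      if i = S.e then min (2 * (co f) none) 1 else 0)
    (by
      intro i
      have h1 := rl_nonneg f (some i)
      have h2 : 0 ≤ min (2 * (co f) none) 1 := le_min (by linarith [rl_nonneg f none]) zero_le_one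
      have h3 : 0 ≤ max (1 - (co f) none) (1/2) := le_max_of_le_right (by norm_num)
      have h4 : 0 ≤ max (1 - 2 * (co f) none) 0 := le_max_right _ _
      split_ifs <;> positivity)
    (fin_add (A_fin f) _ _ _)
    (by
      have key : ∀ i, ((max (1 - 2 * (co f) none) 0 / max (1 - (co f) none) (1/2)) * (co f) (some i) +
          if i = S.e then min (2 * (co f) none) 1 else 0) ≠ 0 →
          (co f) (some i) ≠ 0 ∨ (i = S.e ∧ (co f) none ≠ 0) := by
        intro i hi
        by_contra! hcon
        apply hi
        rw [hcon.1]
        split_ifs with h1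
        · simp [hcon.2 h1]
        · simp
      intro i j hi hj hij
      rcases key i hi with h1 | h1 <;> rcases key j hj with h2 | h2
      · exact A_pair h1 h2 hij
      · obtain ⟨rfl, h3⟩ := h2
        exact S.symm _ _ (A_d h3 h1)
      · obtain ⟨rfl, h3⟩ := h1
        exact A_d h3 h2
      · exact absurd (h1.1.trans h2.1.symm) hij)
    (by
      convert sum_add (hasSum_opt_inv (rl_sum f)) S.e _ _ using 1
      rcases le_total ((co f) none) (1/2) with h | h
      · have h5 : 1 - (co f) none ≠ 0 := by linarith
        rw [max_eq_left (by linarith), max_eq_left (by linarith), min_eq_left (by linarith)]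
        field_simp
        ring
      · rw [max_eq_right (by linarith), min_eq_right (by linarith)]
        simp)

/-- The link coordinate. -/
def lk (f : S.A) (h0 : 0 < (co f) none) (h1 : (co f) none < 1) : S.L :=
  rlMk (fun i => (co f) (some i.1) / (1 - (co f) none))
    (fun i => div_nonneg (rl_nonneg f _) (by linarith))
    (by
      refine ((A_fin f).preimage (Subtype.val_injective.injOn)).subset ?_
      intro i hi h
      exact hi (by simp [show (co f) (some i.1) = 0 from h]))
    (by
      intro i j hi hj hij
      exact A_pair (f := f) (fun h => hi (by simp [h])) (fun h => hj (by simp [h]))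
        (fun h => hij (Subtype.ext h)))
    (by
      have h := (hasSum_opt_inv (rl_sum f)).div_const (1 - (co f) none)
      rw [div_self (by linarith)] at h
      refine (hasSum_subtype_iff_of_support_subset (s := {i | S.d S.e i}) ?_).2 h
      intro i hi
      exact A_d h0.ne' (fun h => hi (by simp [h])))

end PS

/-! ### Suspensions and wedges -/

theorem cont_susp_mk {X : Type*} [TopologicalSpace X] :
    Continuous (fun z : (X × Set.Icc (0:ℝ) 1) ⊕ Bool => (Quot.mk _ z : Susp X)) :=
  continuous_quot_mk

theorem cont_wedge_mk {X Y : Type*} [TopologicalSpace X] [TopologicalSpace Y] (x : X) (y : Y) :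
    Continuous (fun z : X ⊕ Y => (Quot.mk _ z : Wedge X Y x y)) :=
  continuous_quot_mk

/-- Lifting a map to the suspension. -/
def suspLift {X Z : Type*} [TopologicalSpace X] (F : X × Set.Icc (0:ℝ) 1 → Z) (z : Bool → Z)
    (h0 : ∀ x : X, F (x, 0) = z false) (h1 : ∀ x : X, F (x, 1) = z true) : Susp X → Z :=
  Quot.lift (Sum.elim F z) (by
    rintro (⟨x, s⟩ | b) (q | b') h
    · exact h.elim
    · rcases h with ⟨h, rfl⟩ | ⟨h, rfl⟩
      · have : s = 0 := Subtype.ext h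
        subst this; exact h0 x
      · have : s = 1 := Subtype.ext h
        subst this; exact h1 x
    · exact h.elim
    · exact h.elim)

theorem suspLift_cont {X Z : Type*} [TopologicalSpace X] [TopologicalSpace Z]
    {F : X × Set.Icc (0:ℝ) 1 → Z} {z : Bool → Z}
    (h0 : ∀ x : X, F (x, 0) = z false) (h1 : ∀ x : X, F (x, 1) = z true) (hF : Continuous F) :
    Continuous (suspLift F z h0 h1) :=
  continuous_quot_lift _ (hF.sumElim continuous_of_discreteTopology)

/-- Lifting a map to the wedge. -/
def wedgeLift {X Y Z : Type*} [TopologicalSpace X] [TopologicalSpace Y] {x : X} {y : Y}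
    (F : X → Z) (G : Y → Z) (h : F x = G y) : Wedge X Y x y → Z :=
  Quot.lift (Sum.elim F G) (by rintro _ _ ⟨rfl, rfl⟩; exact h)

theorem wedgeLift_cont {X Y Z : Type*} [TopologicalSpace X] [TopologicalSpace Y]
    [TopologicalSpace Z] {x : X} {y : Y}
    {F : X → Z} {G : Y → Z} (h : F x = G y) (hF : Continuous F) (hG : Continuous G) :
    Continuous (wedgeLift F G h : Wedge X Y x y → Z) :=
  continuous_quot_lift _ (hF.sumElim hG)

namespace PS
open Classical
variable {α : Type*} {S : PS α}

/-- A pole of the suspension. -/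
def pole (b : Bool) : Susp S.L := Quot.mk _ (Sum.inr b)

variable (S) in
/-- The target wedge. -/
abbrev W := Wedge S.X (Susp S.L) eX (pole false)

def inX (f : S.X) : S.W := Quot.mk _ (Sum.inl f)
def inS (z : Susp S.L) : S.W := Quot.mk _ (Sum.inr z)
def sm (l : S.L) (s : Set.Icc (0:ℝ) 1) : Susp S.L := Quot.mk _ (Sum.inl (l, s))

theorem glue : (inX eX : S.W) = inS (pole false) := Quot.sound ⟨rfl, rfl⟩

theorem sm_zero (l : S.L) {s : Set.Icc (0:ℝ) 1} (h : s.1 = 0) : sm l s = pole false :=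
  Quot.sound (Or.inl ⟨h, rfl⟩)
theorem sm_one (l : S.L) {s : Set.Icc (0:ℝ) 1} (h : s.1 = 1) : sm l s = pole true :=
  Quot.sound (Or.inr ⟨h, rfl⟩)

theorem inX_cont : Continuous (inX : S.X → S.W) := (cont_wedge_mk _ _).comp continuous_inl
theorem inS_cont : Continuous (inS : Susp S.L → S.W) := (cont_wedge_mk _ _).comp continuous_inr
theorem sm_cont : Continuous fun q : S.L × Set.Icc (0:ℝ) 1 => sm q.1 q.2 :=
  cont_susp_mk.comp continuous_inl

theorem RX_cont : Continuous fun q : S.L × Set.Icc (0:ℝ) 1 => RX q.1 q.2 := by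
  refine rl_cont fun i => ?_
  simp only [RX, co_rlMk]
  have := (ext_cont (S := S) i).comp (continuous_fst (Y := Set.Icc (0:ℝ) 1))
  refine Continuous.add (Continuous.mul (by fun_prop) this) ?_
  split_ifs <;> fun_prop

theorem R_cont : Continuous fun q : S.L × Set.Icc (-1:ℝ) 1 => R q.1 q.2 := by
  refine rl_cont fun o => ?_
  cases o with
  | none =>
    simp only [R, co_rlMk, Option.elim]
    fun_prop
  | some i =>
    simp only [R, co_rlMk, Option.elim]
    have := (ext_cont (S := S) i).comp (continuous_fst (Y := Set.Icc (-1:ℝ) 1))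
    refine Continuous.add (Continuous.mul (by fun_prop) this) ?_
    split_ifs <;> fun_prop

theorem RX_one (l : S.L) {v : Set.Icc (0:ℝ) 1} (h : v.1 = 1) : RX l v = eX := by
  refine rl_ext fun i => ?_
  simp [RX, eX, h]

/-- The map to the wedge, following a segment in `X` and then the suspension. -/
def Q (q : S.L × Set.Icc (-1:ℝ) 1) : S.W :=
  if q.2.1 ≤ 0 then inX (RX q.1 (Set.projIcc 0 1 zero_le_one (1 + q.2.1)))
  else inS (sm q.1 (Set.projIcc 0 1 zero_le_one q.2.1))

theorem Q_cont : Continuous (Q : S.L × Set.Icc (-1:ℝ) 1 → S.W) := by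
  unfold Q
  refine Continuous.if_le ?_ ?_ (by fun_prop) continuous_const ?_
  · exact inX_cont.comp (RX_cont.comp (continuous_fst.prodMk
      ((continuous_projIcc (h := zero_le_one)).comp (by fun_prop))))
  · exact inS_cont.comp (sm_cont.comp (continuous_fst.prodMk
      ((continuous_projIcc (h := zero_le_one)).comp (by fun_prop))))
  · intro q hq
    rw [hq, RX_one _ (by simp), sm_zero _ (by simp), glue]

theorem Q_neg (l : S.L) {u : Set.Icc (-1:ℝ) 1} (h : u.1 ≤ 0) :
    Q (l, u) = inX (RX l ⟨1 + u.1, by linarith [u.2.1], by linarith⟩) := by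
  unfold Q
  rw [if_pos h]
  congr 2
  exact Set.projIcc_of_mem zero_le_one ⟨by linarith [u.2.1], by linarith⟩

theorem Q_pos (l : S.L) {u : Set.Icc (-1:ℝ) 1} (h : 0 ≤ u.1) :
    Q (l, u) = inS (sm l ⟨u.1, h, u.2.2⟩) := by
  rcases h.eq_or_lt with h0 | h0
  · rw [Q_neg l h0.symm.le, RX_one _ (by simp [← h0]), sm_zero _ (by simp [← h0]), glue]
  · unfold Q
    rw [if_neg (not_le.2 h0)]
    congr 2
    exact Set.projIcc_of_mem zero_le_one ⟨h, u.2.2⟩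

theorem Q_zero (l : S.L) {u : Set.Icc (-1:ℝ) 1} (h : u.1 = 0) : Q (l, u) = inX eX := by
  rw [Q_pos l h.ge, sm_zero _ (by simpa using h), glue]

theorem Q_one (l : S.L) {u : Set.Icc (-1:ℝ) 1} (h : u.1 = 1) : Q (l, u) = inS (pole true) := by
  rw [Q_pos l (by rw [h]; norm_num), sm_one _ (by simpa using h)]

/-- The reparametrization used in `phi`. -/
def hp (t : Set.Icc (0:ℝ) 1) : Set.Icc (-1:ℝ) 1 :=
  ⟨max (2 * t.1 - 1) (min (4 * t.1 - 2) 1), le_max_of_le_left (by linarith [t.2.1]),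
    max_le (by linarith [t.2.2]) (min_le_right _ _)⟩

theorem hp_cont : Continuous hp := by
  unfold hp; fun_prop

theorem hp_le {t : Set.Icc (0:ℝ) 1} (h : t.1 ≤ 1/2) : (hp t).1 = 2 * t.1 - 1 :=
  max_eq_left ((min_le_left _ _).trans (by linarith))

theorem hp_ge {t : Set.Icc (0:ℝ) 1} (h : 1/2 ≤ t.1) : (hp t).1 = min (4 * t.1 - 2) 1 :=
  max_eq_right (le_min (by linarith) (by linarith [t.2.2]))

/-- The coordinate of the new vertex. -/
def tt (f : S.A) : Set.Icc (0:ℝ) 1 := ⟨co f none, rl_nonneg f none, rl_le_one f none⟩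

theorem tt_cont : Continuous (tt : S.A → _) := (rl_coord none).subtype_mk _

/-- The homotopy equivalence. -/
def phi (f : S.A) : S.W :=
  if h : 1/2 < co f none ∧ co f none < 1 then
    Q (lk f (lt_trans (by norm_num) h.1) h.2, hp (tt f))
  else if co f none ≤ 1/2 then inX (g f) else inS (pole true)

theorem phi_le {f : S.A} (h : co f none ≤ 1/2) : phi f = inX (g f) := by
  unfold phi
  rw [dif_neg (fun h' => absurd h'.1 (not_lt.2 h)), if_pos h]

theorem f_zero {f : S.A} (h0 : 0 < co f none) {i : α} (h : ¬ S.d S.e i) : co f (some i) = 0 := by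
  by_contra hn
  exact h (A_d h0.ne' hn)

theorem ext_lk {f : S.A} (h0 : 0 < co f none) (h1 : co f none < 1) (i : α) :
    ext (lk f h0 h1) i = co f (some i) / (1 - co f none) := by
  by_cases h : S.d S.e i
  · simp [ext, h, lk]
  · simp [ext, h, f_zero h0 h]

theorem phi_mid {f : S.A} (h0 : 0 < co f none) (h1 : co f none < 1) :
    phi f = Q (lk f h0 h1, hp (tt f)) := by
  by_cases h : co f none ≤ 1/2
  · rw [phi_le h]
    have ht : (hp (tt f)).1 = 2 * co f none - 1 := hp_le h
    rw [Q_neg _ (by rw [ht]; linarith)]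
    congr 1
    refine rl_ext fun i => ?_
    simp only [g, RX, co_rlMk, ext_lk, ht]
    rw [max_eq_left (by linarith), max_eq_left (by linarith), min_eq_left (by linarith)]
    have : 1 - co f none ≠ 0 := by linarith
    rw [show (1:ℝ) + (2 * co f none - 1) = 2 * co f none by ring]
    congr 1
    ring
  · unfold phi
    rw [dif_pos ⟨not_le.1 h, h1⟩]

theorem phi_ge {f : S.A} (h : 3/4 ≤ co f none) : phi f = inS (pole true) := by
  by_cases h1 : co f none < 1
  · rw [phi_mid (by linarith) h1]
    refine Q_one _ ?_
    rw [hp_ge (show (1/2:ℝ) ≤ co f none by linarith)]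
    exact min_eq_right (show (1:ℝ) ≤ 4 * co f none - 2 by linarith)
  · unfold phi
    rw [dif_neg (fun h' => h1 h'.2), if_neg (by linarith)]

theorem g_cont : Continuous (g : S.A → S.X) := by
  refine rl_cont fun i => ?_
  simp only [g, co_rlMk]
  have h0 := rl_coord (d := S.dA) none
  have h1 := rl_coord (d := S.dA) (some i)
  refine Continuous.add (Continuous.mul (Continuous.div ?_ ?_ ?_) h1) ?_
  · exact (continuous_const.sub (continuous_const.mul h0)).max continuous_const
  · exact (continuous_const.sub h0).max continuous_const
  · intro f
    exact (lt_of_lt_of_le (by norm_num) (le_max_right _ _)).ne'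
  · split_ifs
    · exact (continuous_const.mul h0).min continuous_const
    · exact continuous_const

theorem phi_cont : Continuous (phi : S.A → S.W) := by
  have h0 := rl_coord (d := S.dA) none
  rw [continuous_iff_continuousAt]
  intro f
  rcases lt_or_ge (co f none) (1/2) with h | h
  · refine (inX_cont.comp g_cont).continuousAt.congr ?_
    filter_upwards [(isOpen_lt h0 continuous_const).mem_nhds h] with x hx
    exact (phi_le (le_of_lt hx)).symm
  rcases lt_or_ge (3/4) (co f none) with h' | h'
  · refine (continuousAt_const (y := inS (pole true))).congr ?_
    filter_upwards [(isOpen_lt continuous_const h0).mem_nhds h'] with x hx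
    exact (phi_ge (le_of_lt hx)).symm
  · have ho : IsOpen {x : S.A | 0 < co x none ∧ co x none < 1} :=
      (isOpen_lt continuous_const h0).inter (isOpen_lt h0 continuous_const)
    have hmem : f ∈ {x : S.A | 0 < co x none ∧ co x none < 1} :=
      ⟨by linarith, by linarith⟩
    refine ContinuousOn.continuousAt ?_ (ho.mem_nhds hmem)
    rw [continuousOn_iff_continuous_domRestrict]
    have : Set.domRestrict {x : S.A | 0 < co x none ∧ co x none < 1} phi =
        fun x => Q (lk x.1 x.2.1 x.2.2, hp (tt x.1)) := by
      funext x
      exact phi_mid x.2.1 x.2.2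
    rw [this]
    refine Q_cont.comp (Continuous.prodMk ?_ (hp_cont.comp (tt_cont.comp continuous_subtype_val)))
    refine rl_cont fun i => ?_
    simp only [lk, co_rlMk]
    refine Continuous.div ((rl_coord _).comp continuous_subtype_val)
      (continuous_const.sub (h0.comp continuous_subtype_val)) ?_
    intro x
    have := x.2.2
    exact (sub_pos.2 this).ne'

theorem emb_cont : Continuous (emb : S.X → S.A) := by
  refine rl_cont fun o => ?_
  cases o with
  | none => exact continuous_const
  | some i => exact rl_coord i

/-- The affine map from the unit interval. -/
def aff (s : Set.Icc (0:ℝ) 1) : Set.Icc (-1:ℝ) 1 :=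
  ⟨2 * s.1 - 1, by linarith [s.2.1], by linarith [s.2.2]⟩

theorem aff_cont : Continuous aff := by unfold aff; fun_prop

theorem R_neg_one (l : S.L) {u : Set.Icc (-1:ℝ) 1} (h : u.1 = -1) : R l u = emb eX := by
  refine rl_ext fun o => ?_
  cases o <;> simp [R, emb, eX, h]

theorem R_one (l : S.L) {u : Set.Icc (-1:ℝ) 1} (h : u.1 = 1) : R l u = nA := by
  refine rl_ext fun o => ?_
  cases o <;> simp [R, nA, h]

/-- The inverse on the suspension. -/
def psiS : Susp S.L → S.A :=
  suspLift (fun q => R q.1 (aff q.2)) (fun b => if b then nA else emb eX)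
    (fun x => by simpa using R_neg_one x (by simp [aff]))
    (fun x => by simpa using R_one x (by simp [aff]; norm_num))

theorem psiS_cont : Continuous (psiS : Susp S.L → S.A) :=
  suspLift_cont _ _ (R_cont.comp (continuous_fst.prodMk (aff_cont.comp continuous_snd)))

/-- The homotopy inverse. -/
def psi : S.W → S.A := wedgeLift emb psiS rfl

theorem psi_cont : Continuous (psi : S.W → S.A) := wedgeLift_cont _ emb_cont psiS_cont

theorem psi_inX (f : S.X) : psi (inX f) = emb f := rfl
theorem psi_sm (l : S.L) (s) : psi (inS (sm l s)) = R l (aff s) := rfl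
theorem psi_pole : psi (inS (pole true) : S.W) = nA := rfl

end PS

namespace PS
open Classical
variable {α : Type*} {S : PS α}

/-! ### The homotopy on `A` -/

/-- Reparametrization for the composite on `A`. -/
def hh (t : ℝ) : ℝ := max (-2 * t) (min (8 * t - 5) 1)
/-- The straight-line homotopy to the identity. -/
def uu (r t : ℝ) : ℝ := (1 - r) * hh t + r * t
/-- The scaling factor of the link coordinates. -/
def cc (r t : ℝ) : ℝ := r + (1 - |uu r t| - r * (1 - t)) / max (1 - t) (1/4)

theorem hh_cont : Continuous hh := by unfold hh; fun_prop
theorem uu_cont : Continuous fun q : ℝ × ℝ => uu q.1 q.2 := by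
  have := hh_cont
  unfold uu; fun_prop
theorem cc_cont : Continuous fun q : ℝ × ℝ => cc q.1 q.2 := by
  have := uu_cont
  unfold cc
  refine Continuous.add (by fun_prop) (Continuous.div (by fun_prop) (by fun_prop) ?_)
  intro q
  exact (lt_of_lt_of_le (by norm_num) (le_max_right _ _)).ne'

theorem hh_le {t : ℝ} (h : t ≤ 1/2) : hh t = -2 * t :=
  max_eq_left ((min_le_left _ _).trans (by linarith))
theorem hh_mid {t : ℝ} (h : 1/2 ≤ t) : hh t = min (8 * t - 5) 1 :=
  max_eq_right (le_min (by linarith) (by linarith))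
theorem hh_ge {t : ℝ} (h : 3/4 ≤ t) : hh t = 1 := by
  rw [hh_mid (by linarith), min_eq_right (by linarith)]

theorem hh_mem {t : ℝ} (h0 : 0 ≤ t) : -1 ≤ hh t ∧ hh t ≤ 1 := by
  constructor
  · rcases le_total t (1/2) with h | h
    · rw [hh_le h]; linarith
    · rw [hh_mid h]; exact le_min (by linarith) (by norm_num)
  · exact max_le (by linarith) (min_le_right _ _)

theorem conv_mem {a b r : ℝ} (ha : -1 ≤ a ∧ a ≤ 1) (hb : -1 ≤ b ∧ b ≤ 1) (h0 : 0 ≤ r)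
    (h1 : r ≤ 1) : -1 ≤ (1 - r) * a + r * b ∧ (1 - r) * a + r * b ≤ 1 := by
  constructor <;> nlinarith

theorem uu_abs {r t : ℝ} (hr : 0 ≤ r) (hr1 : r ≤ 1) (h0 : 0 ≤ t) (h1 : t ≤ 1) : |uu r t| ≤ 1 :=
  abs_le.2 (conv_mem (hh_mem h0) ⟨by linarith, h1⟩ hr hr1)

theorem cc_ge {r t : ℝ} (hr : 0 ≤ r) (hr1 : r ≤ 1) (h1 : t ≤ 1) (h : 3/4 ≤ t) : cc r t = r := by
  have h2 : uu r t = 1 - r * (1 - t) := by unfold uu; rw [hh_ge h]; ring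
  have h3 : 0 ≤ uu r t := by rw [h2]; nlinarith
  unfold cc
  rw [abs_of_nonneg h3, h2]
  simp

theorem cc_le {r t : ℝ} (h : t ≤ 3/4) : cc r t = (1 - |uu r t|) / (1 - t) := by
  unfold cc
  have : 1 - t ≠ 0 := by linarith
  rw [max_eq_left (by linarith)]
  field_simp
  ring

theorem cc_mul {r t : ℝ} (hr : 0 ≤ r) (hr1 : r ≤ 1) (h1 : t ≤ 1) :
    cc r t * (1 - t) = 1 - |uu r t| := by
  rcases le_total t (3/4) with h | h
  · rw [cc_le h]
    have : 1 - t ≠ 0 := by linarith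
    field_simp
  · rw [cc_ge hr hr1 h1 h]
    have h2 : uu r t = 1 - r * (1 - t) := by unfold uu; rw [hh_ge h]; ring
    have h3 : 0 ≤ uu r t := by rw [h2]; nlinarith
    rw [abs_of_nonneg h3, h2]
    ring

theorem cc_nonneg {r t : ℝ} (hr : 0 ≤ r) (hr1 : r ≤ 1) (h0 : 0 ≤ t) (h1 : t ≤ 1) :
    0 ≤ cc r t := by
  rcases le_total t (3/4) with h | h
  · rw [cc_le h]
    exact div_nonneg (by linarith [uu_abs hr hr1 h0 h1]) (by linarith)
  · rw [cc_ge hr hr1 h1 h]; exact hr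

/-- The homotopy on `A`. -/
def HA (q : unitInterval × S.A) : S.A :=
  P q.2 (uu q.1.1 (co q.2 none)) (cc q.1.1 (co q.2 none))
    (cc_nonneg q.1.2.1 q.1.2.2 (rl_nonneg _ _) (rl_le_one _ _))
    (cc_mul q.1.2.1 q.1.2.2 (rl_le_one _ _))
    (fun h => by rw [h]; simp [uu, hh])

theorem HA_cont : Continuous (HA : unitInterval × S.A → S.A) := by
  have hq : Continuous fun q : unitInterval × S.A => ((q.1.1, co q.2 none) : ℝ × ℝ) :=
    (continuous_subtype_val.comp continuous_fst).prodMk ((rl_coord none).comp continuous_snd)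
  have hu : Continuous fun q : unitInterval × S.A => uu q.1.1 (co q.2 none) := uu_cont.comp hq
  have hc : Continuous fun q : unitInterval × S.A => cc q.1.1 (co q.2 none) := cc_cont.comp hq
  refine rl_cont fun o => ?_
  cases o with
  | none => exact hu.max continuous_const
  | some i =>
    simp only [HA, P, co_rlMk, Option.elim]
    refine (hc.mul ((rl_coord (some i)).comp continuous_snd)).add ?_
    split_ifs
    · exact hu.neg.max continuous_const
    · exact continuous_const

theorem HA_one (f : S.A) : HA (1, f) = f := by
  refine rl_ext fun o => ?_
  have h0 := rl_nonneg f none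
  have hu : uu 1 (co f none) = co f none := by simp [uu]
  have hc : cc 1 (co f none) = 1 := by
    unfold cc; rw [hu, abs_of_nonneg h0]; simp
  cases o with
  | none => simp [HA, P, hu, h0]
  | some i => simp [HA, P, hu, hc, h0]

theorem HA_zero (f : S.A) : HA (0, f) = psi (phi f) := by
  have h0 := rl_nonneg f none
  have h1 := rl_le_one f none
  have hu : uu 0 (co f none) = hh (co f none) := by simp [uu]
  have hm := cc_mul (r := 0) le_rfl zero_le_one h1
  rw [hu] at hm
  rcases le_or_gt (co f none) (1/2) with h | h
  · rw [phi_le h, psi_inX]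
    have hc := cc_le (r := 0) (t := co f none) (by linarith)
    rw [hu, hh_le h, abs_of_nonpos (by linarith)] at hc
    refine rl_ext fun o => ?_
    cases o with
    | none => simp [HA, P, hu, hh_le h, emb, h0]
    | some i =>
      simp only [HA, P, co_rlMk, emb, g, Option.elim, Set.Icc.coe_zero]
      rw [hc, hu, hh_le h, max_eq_left (by linarith), max_eq_left (by linarith),
        max_eq_left (by linarith), min_eq_left (by linarith)]
      congr 2
      · congr 1; ring
      · ring
  · rcases h1.lt_or_eq with h2 | h2
    · have hpe : (hp (tt f)).1 = min (4 * co f none - 2) 1 := hp_ge h.le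
      have hp0 : 0 ≤ (hp (tt f)).1 := by
        rw [hpe]; exact le_min (by linarith) zero_le_one
      rw [phi_mid (by linarith) h2, Q_pos _ hp0, psi_sm]
      have hx : 2 * (hp (tt f)).1 - 1 = hh (co f none) := by
        rw [hpe, hh_mid h.le]
        rcases le_total (4 * co f none - 2) 1 with h3 | h3
        · rw [min_eq_left h3, min_eq_left (by linarith)]; ring
        · rw [min_eq_right h3, min_eq_right (by linarith)]; ring
      have hne : 1 - co f none ≠ 0 := by linarith
      refine rl_ext fun o => ?_
      cases o with
      | none => simp [HA, P, R, aff, hu, hx]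
      | some i =>
        simp only [HA, P, co_rlMk, R, aff, Option.elim, Set.Icc.coe_zero, hx, hu]
        rw [← hm, ext_lk]
        congr 1
        field_simp
    · rw [phi_ge (by linarith), psi_pole]
      refine rl_ext fun o => ?_
      cases o with
      | none => simp [HA, P, hu, nA, hh_ge (show (3:ℝ)/4 ≤ co f none by linarith)]
      | some i =>
        simp [HA, P, hu, nA, hh_ge (show (3:ℝ)/4 ≤ co f none by linarith),
          rl_vertex f h2 (show some i ≠ none by simp)]

/-! ### The homotopy on the wedge -/

/-- Reparametrization for the composite on the wedge. -/
def kk (s : ℝ) : ℝ := max (-2 * s) (max (4 * s - 3) (min (8 * s - 6) 1))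

theorem kk_cont : Continuous kk := by unfold kk; fun_prop

theorem kk_le {s : ℝ} (h : s ≤ 1/2) : kk s = -2 * s :=
  max_eq_left (max_le (by linarith) ((min_le_left _ _).trans (by linarith)))

theorem kk_ge {s : ℝ} (h : 1/2 ≤ s) : kk s = max (4 * s - 3) (min (8 * s - 6) 1) :=
  max_eq_right (le_max_of_le_left (by linarith))

theorem kk_one : kk 1 = 1 := by norm_num [kk]

theorem kk_mem {s : ℝ} (h0 : 0 ≤ s) (h1 : s ≤ 1) : -1 ≤ kk s ∧ kk s ≤ 1 := by
  constructor
  · rcases le_total s (1/2) with h | h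
    · rw [kk_le h]; linarith
    · rw [kk_ge h]; exact le_max_of_le_left (by linarith)
  · exact max_le (by linarith) (max_le (by linarith) (min_le_right _ _))

/-- The interpolated parameter. -/
def ku (r s : unitInterval) : Set.Icc (-1:ℝ) 1 :=
  ⟨(1 - r.1) * kk s.1 + r.1 * s.1,
    conv_mem (kk_mem s.2.1 s.2.2) ⟨by linarith [s.2.1], s.2.2⟩ r.2.1 r.2.2⟩

theorem ku_cont : Continuous fun q : unitInterval × unitInterval => ku q.1 q.2 := by
  have := kk_cont
  unfold ku
  fun_prop

theorem phi_emb (f : S.X) : phi (emb f) = inX f := by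
  have h : co (emb f) none = 0 := rfl
  rw [phi_le (by rw [h]; norm_num)]
  congr 1
  refine rl_ext fun i => ?_
  simp only [g, co_rlMk, h]
  norm_num
  rfl

theorem phi_R (l : S.L) (s : unitInterval) {u : Set.Icc (-1:ℝ) 1} (hu : u.1 = kk s.1) :
    phi (R l (aff s)) = Q (l, u) := by
  have ht : co (R l (aff s)) none = max (2 * s.1 - 1) 0 := rfl
  rcases le_or_gt s.1 (1/2) with h | h
  · rw [max_eq_right (by linarith)] at ht
    rw [phi_le (by rw [ht]; norm_num)]
    rw [kk_le h] at hu
    rw [Q_neg _ (by rw [hu]; linarith [s.2.1])]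
    congr 1
    refine rl_ext fun i => ?_
    simp only [g, RX, co_rlMk, ht, hu]
    simp only [R, aff, co_rlMk, Option.elim]
    rw [abs_of_nonpos (by linarith), max_eq_left (show (0:ℝ) ≤ -(2 * s.1 - 1) by linarith)]
    norm_num
    split_ifs <;> ring
  · rw [max_eq_left (by linarith)] at ht
    rcases s.2.2.lt_or_eq with h1 | h1
    · rw [phi_mid (by rw [ht]; linarith) (by rw [ht]; linarith)]
      congr 2
      · refine rl_ext fun i => ?_
        have hie : i.1 ≠ S.e := fun hie => S.irr (by simpa [hie] using i.2)
        simp only [lk, co_rlMk, ht]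
        simp only [R, aff, co_rlMk, Option.elim]
        rw [abs_of_nonneg (by linarith), if_neg hie]
        have h3 : 1 - (2 * s.1 - 1) ≠ 0 := by linarith
        simp only [ext, i.2, dif_pos]
        field_simp
        ring
      · refine Subtype.ext ?_
        rw [hu, kk_ge h.le]
        simp only [hp, tt, ht]
        congr 1
        · ring
        · congr 1; ring
    · rw [phi_ge (by rw [ht, h1]; norm_num), Q_one _ (by rw [hu, h1, kk_one])]

/-- The homotopy on the cylinder part, curried. -/
def HQ : C(S.L × unitInterval, C(unitInterval, S.W)) :=
  ContinuousMap.curry ⟨fun q : (S.L × unitInterval) × unitInterval => Q (q.1.1, ku q.2 q.1.2), by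
    refine Q_cont.comp ((continuous_fst.comp continuous_fst).prodMk ?_)
    exact ku_cont.comp (continuous_snd.prodMk (continuous_snd.comp continuous_fst))⟩

theorem HQ_apply (l : S.L) (s r : unitInterval) : HQ (l, s) r = Q (l, ku r s) := rfl

/-- The homotopy on the suspension, curried. -/
def HS : Susp S.L → C(unitInterval, S.W) :=
  suspLift HQ (fun b => ContinuousMap.const _ (inS (pole b)))
    (fun x => by
      ext r
      rw [HQ_apply, Q_zero _ (by simp [ku, kk]), glue]
      rfl)
    (fun x => by
      ext r
      rw [HQ_apply, Q_one _ (by simp [ku, kk_one])]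
      rfl)

theorem HS_cont : Continuous (HS : Susp S.L → C(unitInterval, S.W)) :=
  suspLift_cont _ _ HQ.continuous

/-- The homotopy on the wedge, curried. -/
def HW : S.W → C(unitInterval, S.W) :=
  wedgeLift (fun f => ContinuousMap.const _ (inX f)) HS (by
    ext r
    exact glue)

theorem HW_cont : Continuous (HW : S.W → C(unitInterval, S.W)) := by
  refine wedgeLift_cont _ ?_ HS_cont
  exact ContinuousMap.continuous_const'.comp inX_cont

theorem HW_zero (w : S.W) : HW w 0 = phi (psi w) := by
  induction w using Quot.ind with | mk w => ?_
  rcases w with f | z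
  · exact (phi_emb f).symm
  · induction z using Quot.ind with | mk z => ?_
    rcases z with ⟨l, s⟩ | b
    · exact (phi_R l s (by simp [ku])).symm
    · cases b with
      | false => exact ((phi_emb eX).trans glue).symm
      | true =>
        refine (phi_ge (f := nA) ?_).symm
        have : co (nA : S.A) none = 1 := rfl
        rw [this]; norm_num

theorem HW_one (w : S.W) : HW w 1 = w := by
  induction w using Quot.ind with | mk w => ?_
  rcases w with f | z
  · rfl
  · induction z using Quot.ind with | mk z => ?_
    rcases z with ⟨l, s⟩ | b
    · have h1 : (ku 1 s).1 = s.1 := by simp [ku]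
      refine (Q_pos l (u := ku 1 s) (by rw [h1]; exact s.2.1)).trans ?_
      have : (⟨(ku 1 s).1, by rw [h1]; exact s.2.1, (ku 1 s).2.2⟩ : Set.Icc (0:ℝ) 1) = s :=
        Subtype.ext h1
      rw [this]
      rfl
    · rfl

variable (S) in
/-- The homotopy equivalence. -/
def equiv : ContinuousMap.HomotopyEquiv S.A S.W where
  toFun := ⟨phi, phi_cont⟩
  invFun := ⟨psi, psi_cont⟩
  left_inv := ⟨{
    toFun := HA
    continuous_toFun := HA_cont
    map_zero_left := HA_zero
    map_one_left := HA_one }⟩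
  right_inv := ⟨{
    toFun := fun q => HW q.2 q.1
    continuous_toFun := by
      have h := HW_cont (S := S)
      exact continuous_eval.comp ((h.comp continuous_snd).prodMk continuous_fst)
    map_zero_left := HW_zero
    map_one_left := HW_one }⟩

end PS

/-- Adding an edge `x` parallel to an edge `e` of a multigraph `G` gives
`M(G ∪ {x}) ≃ M(G) ∨ Σ M(G \ EN[e])`. -/
theorem multigraph_parallel_edge_wedge
    {V : Type*} (M : Multigraph V) (e : M.E) :
    ∃ (x : realization M.matchingComplex)
      (y : Susp (realization (Multigraph.matchingComplex
        (⟨{i : M.E // ∀ v, v ∈ M.ends e → v ∉ M.ends i},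
          fun i => M.ends i.1⟩ : Multigraph V)))),
      Nonempty (ContinuousMap.HomotopyEquiv
        (realization (Multigraph.matchingComplex
          (⟨Option M.E, fun o => o.elim (M.ends e) M.ends⟩ : Multigraph V)))
        (Wedge _ _ x y)) := by
  let S : PS M.E :=
    { d := fun i j => ∀ v, v ∈ M.ends i → v ∉ M.ends j
      e := e
      symm := fun i j h v hj hi => h v hi hj
      irr := fun h => by
        obtain ⟨v, hv⟩ : ∃ v, v ∈ M.ends e := ⟨_, Sym2.out_fst_mem _⟩
        exact h v hv hv }
  have hA : Multigraph.matchingComplex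
      (⟨Option M.E, fun o => o.elim (M.ends e) M.ends⟩ : Multigraph V) = cpx S.dA := by
    have hends : ∀ o : Option M.E, o.elim (M.ends e) M.ends = M.ends (o.getD e) := by
      rintro (_ | i) <;> rfl
    ext s
    simp only [Multigraph.matchingComplex, cpx, PS.dA, Set.mem_setOf_eq, hends]
    rfl
  rw [hA]
  exact ⟨PS.eX (S := S), PS.pole (S := S) false, ⟨PS.equiv S⟩⟩
end
end

section
/- If simplicial complexes K1 and K2 are each either contractible or homotopy equivalent to a wedge of spheres, then their join K1 * K2 is contractible or homotopy equivalent to a wedge of spheres. -/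
noncomputable section

/-- The simplicial join of two complexes, on the disjoint union of the vertex sets. -/
def joinComplex {α β : Type*} [DecidableEq α] [DecidableEq β] (K : Set (Finset α)) (L : Set (Finset β)) :
    Set (Finset (α ⊕ β)) :=
  {u | ∃ s ∈ K, ∃ t ∈ L, u = s.image Sum.inl ∪ t.image Sum.inr}

/-! ### The coarse join -/

open Topology Set Filter unitInterval

/-- `X` with an extra point whose only neighbourhood is everything. -/
def Lft (X : Type*) := Option X

namespace Lft

def some {X : Type*} (x : X) : Lft X := Option.some x
def none {X : Type*} : Lft X := Option.none
def map {X Y : Type*} (f : X → Y) (x : Lft X) : Lft Y := Option.map f x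

theorem some_ne_none {X : Type*} (x : X) : Lft.some x ≠ Lft.none := by
  intro h; cases h

theorem none_ne_some {X : Type*} (x : X) : (Lft.none : Lft X) ≠ Lft.some x := by
  intro h; cases h

theorem some_inj {X : Type*} {x y : X} : Lft.some x = Lft.some y ↔ x = y :=
  Option.some_inj

theorem cases' {X : Type*} (z : Lft X) : z = none ∨ ∃ x, z = some x := by
  cases z with
  | none => exact Or.inl rfl
  | some x => exact Or.inr ⟨x, rfl⟩

@[simp] theorem map_some {X Y : Type*} (f : X → Y) (x : X) : (some x).map f = some (f x) := rfl
@[simp] theorem map_none {X Y : Type*} (f : X → Y) : (none : Lft X).map f = none := rfl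

theorem map_eq_none {X Y : Type*} (f : X → Y) (z : Lft X) : z.map f = none ↔ z = none := by
  rcases cases' z with rfl | ⟨x, rfl⟩
  · simp
  · simp [some_ne_none]

variable {X Y Z S : Type*} [TopologicalSpace X] [TopologicalSpace Y] [TopologicalSpace Z]
  [TopologicalSpace S]

instance : TopologicalSpace (Lft X) where
  IsOpen s := IsOpen (Lft.some ⁻¹' s) ∧ (Lft.none ∈ s → s = univ)
  isOpen_univ := ⟨isOpen_univ, fun _ => rfl⟩
  isOpen_inter s t hs ht := by
    refine ⟨hs.1.inter ht.1, fun h => ?_⟩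
    rw [hs.2 h.1, ht.2 h.2, inter_univ]
  isOpen_sUnion S hS := by
    refine ⟨?_, ?_⟩
    · rw [preimage_sUnion]
      exact isOpen_biUnion fun t ht => (hS t ht).1
    · rintro ⟨t, ht, h⟩
      have := (hS t ht).2 h
      subst this
      exact eq_univ_of_univ_subset (subset_sUnion_of_mem ht)

theorem isOpen_iff {s : Set (Lft X)} :
    IsOpen s ↔ IsOpen (Lft.some ⁻¹' s) ∧ (Lft.none ∈ s → s = univ) := Iff.rfl

theorem isOpenEmbedding_some : IsOpenEmbedding (Lft.some : X → Lft X) := by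
  refine IsOpenEmbedding.of_continuous_injective_isOpenMap ?_ ?_ ?_
  · exact ⟨fun s hs => hs.1⟩
  · exact fun x y h => some_inj.1 h
  · intro U hU
    refine ⟨?_, ?_⟩
    · rwa [preimage_image_eq]
      exact fun x y h => some_inj.1 h
    · rintro ⟨x, _, h⟩
      exact absurd h (some_ne_none x)

theorem nhds_some (x : X) : 𝓝 (Lft.some x) = Filter.map Lft.some (𝓝 x) :=
  (isOpenEmbedding_some.map_nhds_eq x).symm

theorem nhds_none : 𝓝 (Lft.none : Lft X) = ⊤ := by
  rw [eq_top_iff]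
  intro s hs
  obtain ⟨t, hts, ht, hn⟩ := mem_nhds_iff.1 hs
  rw [ht.2 hn] at hts
  exact mem_top.2 (eq_univ_of_univ_subset hts)

theorem continuousAt_none {f : Z → Lft X} {z : Z} (h : f z = none) : ContinuousAt f z := by
  unfold ContinuousAt
  rw [h, nhds_none]
  exact tendsto_top

theorem isOpen_ne_none : IsOpen {z : Lft X | z ≠ none} := by
  refine ⟨?_, fun h => absurd rfl h⟩
  convert isOpen_univ (X := X)
  ext x; simp [some_ne_none]

/-- gluing a partial function defined on an open set -/
theorem continuous_of_open {f : Z → Lft X} (hO : IsOpen {z | f z ≠ none})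
    (g : {z | f z ≠ none} → X) (hg : Continuous g) (hfg : ∀ z, f z.1 = some (g z)) :
    Continuous f := by
  rw [continuous_iff_continuousAt]
  intro z
  by_cases hz : f z = none
  · exact continuousAt_none hz
  · have h1 : Continuous (f ∘ (Subtype.val : {z | f z ≠ none} → Z)) := by
      have : f ∘ (Subtype.val : {z | f z ≠ none} → Z) = Lft.some ∘ g := by
        funext z; exact hfg z
      rw [this]
      exact isOpenEmbedding_some.continuous.comp hg
    have := (hO.isOpenEmbedding_subtypeVal.continuousAt_iff (g := f) (x := ⟨z, hz⟩)).1
      h1.continuousAt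
    exact this

theorem continuous_map' {f : X × S → Y} (hf : Continuous f) :
    Continuous (fun p : Lft X × S => p.1.map (fun x => f (x, p.2))) := by
  rw [continuous_iff_continuousAt]
  rintro ⟨z, s⟩
  rcases cases' z with rfl | ⟨x, rfl⟩
  · exact continuousAt_none rfl
  · have h1 : IsOpenEmbedding (Prod.map Lft.some id : X × S → Lft X × S) :=
      isOpenEmbedding_some.prodMap IsOpenEmbedding.id
    refine (h1.continuousAt_iff (x := (x, s))).1 ?_
    exact (isOpenEmbedding_some.continuous.comp hf).continuousAt

theorem separated {x y : X} [T2Space X] (h : x ≠ y) :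
    ∃ u v : Set (Lft X), IsOpen u ∧ IsOpen v ∧ some x ∈ u ∧ some y ∈ v ∧ Disjoint u v := by
  obtain ⟨u, v, hu, hv, hx, hy, hd⟩ := t2_separation h
  refine ⟨_, _, isOpenEmbedding_some.isOpenMap u hu, isOpenEmbedding_some.isOpenMap v hv,
    mem_image_of_mem _ hx, mem_image_of_mem _ hy, ?_⟩
  exact (disjoint_image_iff (fun x y h => some_inj.1 h)).2 hd

end Lft

/-- The join with coarse topology. -/
def CJoin (X Y : Type*) [TopologicalSpace X] [TopologicalSpace Y] : Type _ :=
  {p : I × Lft X × Lft Y // (p.2.1 = Lft.none ↔ p.1 = 1) ∧ (p.2.2 = Lft.none ↔ p.1 = 0)}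

namespace CJoin

variable {X Y Z S X' Y' : Type*} [TopologicalSpace X] [TopologicalSpace Y] [TopologicalSpace Z]
  [TopologicalSpace S] [TopologicalSpace X'] [TopologicalSpace Y']

instance : TopologicalSpace (CJoin X Y) := instTopologicalSpaceSubtype

def mapS (f : X × S → X') (g : Y × S → Y') (p : CJoin X Y × S) : CJoin X' Y' :=
  ⟨(p.1.1.1, p.1.1.2.1.map (fun x => f (x, p.2)), p.1.1.2.2.map (fun y => g (y, p.2))), by
    have := p.1.2
    simpa only [Lft.map_eq_none] using this⟩

theorem continuous_mapS {f : X × S → X'} {g : Y × S → Y'} (hf : Continuous f)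
    (hg : Continuous g) : Continuous (mapS f g) := by
  have h0 : Continuous (fun p : CJoin X Y × S => p.1.1) :=
    continuous_subtype_val.comp continuous_fst
  refine Continuous.subtype_mk ?_ _
  refine (continuous_fst.comp h0).prodMk (Continuous.prodMk ?_ ?_)
  · exact (Lft.continuous_map' hf).comp
      (f := fun p : CJoin X Y × S => (p.1.1.2.1, p.2))
      (((continuous_fst.comp continuous_snd).comp h0).prodMk continuous_snd)
  · exact (Lft.continuous_map' hg).comp
      (f := fun p : CJoin X Y × S => (p.1.1.2.2, p.2))
      (((continuous_snd.comp continuous_snd).comp h0).prodMk continuous_snd)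

def map (f : C(X, X')) (g : C(Y, Y')) : C(CJoin X Y, CJoin X' Y') where
  toFun p := mapS (fun x : X × Unit => f x.1) (fun y : Y × Unit => g y.1) (p, ())
  continuous_toFun := (continuous_mapS (by fun_prop) (by fun_prop)).comp (by fun_prop)

theorem ext' {p q : CJoin X Y} (h1 : p.1.1 = q.1.1) (h2 : p.1.2.1 = q.1.2.1)
    (h3 : p.1.2.2 = q.1.2.2) : p = q :=
  Subtype.ext (Prod.ext h1 (Prod.ext h2 h3))

theorem map_comp {X'' Y'' : Type*} [TopologicalSpace X''] [TopologicalSpace Y'']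
    (f : C(X, X')) (g : C(Y, Y')) (f' : C(X', X'')) (g' : C(Y', Y'')) :
    (map f' g').comp (map f g) = map (f'.comp f) (g'.comp g) := by
  ext p
  apply ext'
  · rfl
  · change Lft.map _ (Lft.map _ p.1.2.1) = Lft.map _ p.1.2.1
    rcases Lft.cases' p.1.2.1 with h | ⟨x, h⟩ <;> rw [h] <;> rfl
  · change Lft.map _ (Lft.map _ p.1.2.2) = Lft.map _ p.1.2.2
    rcases Lft.cases' p.1.2.2 with h | ⟨x, h⟩ <;> rw [h] <;> rfl

theorem map_id : map (ContinuousMap.id X) (ContinuousMap.id Y) = ContinuousMap.id _ := by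
  ext p
  apply ext'
  · rfl
  · change Lft.map _ p.1.2.1 = p.1.2.1
    rcases Lft.cases' p.1.2.1 with h | ⟨x, h⟩ <;> rw [h] <;> rfl
  · change Lft.map _ p.1.2.2 = p.1.2.2
    rcases Lft.cases' p.1.2.2 with h | ⟨x, h⟩ <;> rw [h] <;> rfl

theorem map_homotopic {f f' : C(X, X')} {g g' : C(Y, Y')} (hf : f.Homotopic f')
    (hg : g.Homotopic g') : (map f g).Homotopic (map f' g') := by
  obtain ⟨F⟩ := hf
  obtain ⟨G⟩ := hg
  refine ⟨⟨⟨fun p => mapS (fun x : X × I => F (x.2, x.1)) (fun y : Y × I => G (y.2, y.1))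
    (p.2, p.1), ?_⟩, ?_, ?_⟩⟩
  · exact (continuous_mapS (by fun_prop) (by fun_prop)).comp (by fun_prop)
  · intro p
    apply ext' <;> simp [mapS, map] <;> rfl
  · intro p
    apply ext' <;> simp [mapS, map] <;> rfl

def hequiv (e : ContinuousMap.HomotopyEquiv X X') (e' : ContinuousMap.HomotopyEquiv Y Y') :
    ContinuousMap.HomotopyEquiv (CJoin X Y) (CJoin X' Y') where
  toFun := map e.toFun e'.toFun
  invFun := map e.invFun e'.invFun
  left_inv := by
    rw [map_comp, ← map_id]; exact map_homotopic e.left_inv e'.left_inv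
  right_inv := by
    rw [map_comp, ← map_id]; exact map_homotopic e.right_inv e'.right_inv

def swap (p : CJoin X Y) : CJoin Y X :=
  ⟨(σ p.1.1, p.1.2.2, p.1.2.1), by
    have h1 := p.2.1
    have h2 := p.2.2
    constructor
    · rw [h2, unitInterval.symm_eq_one]
    · rw [h1, unitInterval.symm_eq_zero]⟩

theorem continuous_swap : Continuous (swap : CJoin X Y → CJoin Y X) := by
  have h0 : Continuous (fun p : CJoin X Y => p.1) := continuous_subtype_val
  refine Continuous.subtype_mk ?_ _
  exact (unitInterval.continuous_symm.comp (continuous_fst.comp h0)).prodMk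
    ((continuous_snd.comp (continuous_snd.comp h0)).prodMk
      (continuous_fst.comp (continuous_snd.comp h0)))

def swapHomeo : CJoin X Y ≃ₜ CJoin Y X where
  toFun := swap
  invFun := swap
  left_inv p := by apply ext' <;> simp [swap]
  right_inv p := by apply ext' <;> simp [swap]
  continuous_toFun := continuous_swap
  continuous_invFun := continuous_swap

/-- join with an empty space -/
theorem homeo_of_isEmpty [IsEmpty X] : Nonempty (CJoin X Y ≃ₜ Y) := by
  have h1 : ∀ p : CJoin X Y, p.1.1 = 1 := fun p => by
    rcases Lft.cases' p.1.2.1 with h | ⟨x, h⟩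
    · exact p.2.1.1 h
    · exact isEmptyElim x
  have h2 : ∀ p : CJoin X Y, ∃ y, p.1.2.2 = Lft.some y := fun p => by
    rcases Lft.cases' p.1.2.2 with h | ⟨x, h⟩
    · have := p.2.2.1 h
      rw [h1 p] at this
      exact absurd this one_ne_zero
    · exact ⟨x, h⟩
  let b : Y → CJoin X Y := fun y => ⟨(1, Lft.none, Lft.some y), by
    simp, by simp [Lft.some_ne_none]⟩
  have hb : Continuous b := by
    refine Continuous.subtype_mk ?_ _
    exact continuous_const.prodMk
      (continuous_const.prodMk Lft.isOpenEmbedding_some.continuous)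
  choose a ha using h2
  have hac : Continuous a := by
    rw [Lft.isOpenEmbedding_some.isEmbedding.continuous_iff]
    have : Lft.some ∘ a = fun p : CJoin X Y => p.1.2.2 := by
      funext p; exact (ha p).symm
    rw [this]
    exact (continuous_snd.comp continuous_snd).comp continuous_subtype_val
  refine ⟨⟨⟨a, b, ?_, ?_⟩, hac, hb⟩⟩
  · intro p
    apply ext'
    · exact (h1 p).symm
    · exact (p.2.1.2 (h1 p)).symm
    · exact (ha p).symm
  · intro y
    have := ha (b y)
    exact (Lft.some_inj.1 this).symm

/-- join with a point -/
theorem contractible_unit : ContractibleSpace (CJoin Unit Y) := by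
  classical
  rw [contractible_iff_id_nullhomotopic]
  have hz : ∀ (s t : I), s * t ≠ 0 → t ≠ 0 := by
    rintro s t h rfl; simp at h
  let c : I × CJoin Unit Y → CJoin Unit Y := fun p =>
    ⟨(σ p.1 * p.2.1.1, if σ p.1 * p.2.1.1 = 1 then Lft.none else Lft.some (),
      if σ p.1 * p.2.1.1 = 0 then Lft.none else p.2.1.2.2), by
      constructor
      · dsimp only; split_ifs with h <;> simp [h, Lft.some_ne_none]
      · dsimp only; split_ifs with h
        · simp [h]
        · rw [p.2.2.2]
          simp only [h, iff_false]
          exact hz _ _ h⟩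
  have ht : Continuous (fun p : I × CJoin Unit Y => σ p.1 * p.2.1.1) :=
    (unitInterval.continuous_symm.comp continuous_fst).mul
      (continuous_fst.comp (continuous_subtype_val.comp continuous_snd))
  have hc : Continuous c := by
    refine Continuous.subtype_mk (ht.prodMk (Continuous.prodMk ?_ ?_)) _
    · rw [continuous_iff_continuousAt]
      intro p
      by_cases h : σ p.1 * p.2.1.1 = 1
      · exact Lft.continuousAt_none (if_pos h)
      · have : ∀ᶠ q in 𝓝 p, σ q.1 * q.2.1.1 ≠ 1 :=
          (isOpen_ne.preimage ht).mem_nhds h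
        refine (continuousAt_const (y := Lft.some ())).congr ?_
        filter_upwards [this] with q hq
        rw [if_neg hq]
    · rw [continuous_iff_continuousAt]
      intro p
      by_cases h : σ p.1 * p.2.1.1 = 0
      · exact Lft.continuousAt_none (if_pos h)
      · have : ∀ᶠ q in 𝓝 p, σ q.1 * q.2.1.1 ≠ 0 :=
          (isOpen_ne.preimage ht).mem_nhds h
        have h3 : Continuous fun p : I × CJoin Unit Y => p.2.1.2.2 :=
          (continuous_snd.comp continuous_snd).comp (continuous_subtype_val.comp continuous_snd)
        refine h3.continuousAt.congr ?_
        filter_upwards [this] with q hq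
        rw [if_neg hq]
  refine ⟨⟨(0, Lft.some (), Lft.none), by simp [Lft.some_ne_none], by simp⟩,
    ⟨⟨⟨c, hc⟩, ?_, ?_⟩⟩⟩
  · intro p
    apply ext'
    · simp [c]
    · simp only [c, unitInterval.symm_zero, one_mul]
      split_ifs with h
      · exact (p.2.1.2 h).symm
      · rcases Lft.cases' p.1.2.1 with h' | ⟨x, h'⟩
        · exact absurd (p.2.1.1 h') h
        · exact h'.symm
    · simp only [c, unitInterval.symm_zero, one_mul]
      split_ifs with h
      · exact (p.2.2.2 h).symm
      · rfl
  · intro p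
    apply ext' <;> simp [c] <;> rfl

theorem contractible_left [ContractibleSpace X] : ContractibleSpace (CJoin X Y) := by
  obtain ⟨e⟩ := ContractibleSpace.hequiv_unit X
  have := contractible_unit (Y := Y)
  exact (hequiv e (ContinuousMap.HomotopyEquiv.refl Y)).contractibleSpace

theorem contractible_right [ContractibleSpace Y] : ContractibleSpace (CJoin X Y) := by
  have := contractible_left (X := Y) (Y := X)
  exact swapHomeo.contractibleSpace

end CJoin

/-! ### The realization of the simplicial join is the coarse join -/

namespace RealJoin

variable {α β : Type*}

def val {K : Set (Finset α)} (z : Lft (realization K)) : α → ℝ :=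
  Option.elim z (fun _ => 0) (fun f => f.1)

@[simp] theorem val_some {K : Set (Finset α)} (f : realization K) :
    val (Lft.some f) = f.1 := rfl
@[simp] theorem val_none {K : Set (Finset α)} :
    val (Lft.none : Lft (realization K)) = fun _ => 0 := rfl

theorem val_nonneg {K : Set (Finset α)} (z : Lft (realization K)) (a : α) : 0 ≤ val z a := by
  rcases Lft.cases' z with rfl | ⟨f, rfl⟩
  · simp
  · exact f.2.1 a

theorem val_le_one {K : Set (Finset α)} (z : Lft (realization K)) (a : α) : val z a ≤ 1 := by
  rcases Lft.cases' z with rfl | ⟨f, rfl⟩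
  · simp
  · obtain ⟨h0, s, -, hs, h1⟩ := f.2
    by_cases ha : a ∈ s
    · exact (Finset.single_le_sum (f := f.1) (fun i _ => h0 i) ha).trans h1.le
    · have : f.1 a = 0 := by
        by_contra h
        exact ha (hs h)
      rw [val_some, this]; exact zero_le_one

theorem val_supp {K : Set (Finset α)} (hK : ∅ ∈ K) (z : Lft (realization K)) :
    ∃ s ∈ K, Function.support (val z) ⊆ ↑s ∧ (z ≠ Lft.none → ∑ a ∈ s, val z a = 1) := by
  rcases Lft.cases' z with rfl | ⟨f, rfl⟩
  · exact ⟨∅, hK, by simp, by simp⟩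
  · obtain ⟨h0, s, hsK, hs, h1⟩ := f.2
    exact ⟨s, hsK, hs, fun _ => h1⟩

variable [DecidableEq α] [DecidableEq β] {K : Set (Finset α)} {L : Set (Finset β)}

/-- weight on the second factor -/
def wt (F : realization (joinComplex K L)) : ℝ := ∑ᶠ b, F.1 (Sum.inr b)

theorem exists_faces (F : realization (joinComplex K L)) :
    ∃ s ∈ K, ∃ t ∈ L, (∀ a, F.1 (Sum.inl a) ≠ 0 → a ∈ s) ∧ (∀ b, F.1 (Sum.inr b) ≠ 0 → b ∈ t) ∧
      wt F = ∑ b ∈ t, F.1 (Sum.inr b) ∧ 1 - wt F = ∑ a ∈ s, F.1 (Sum.inl a) := by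
  obtain ⟨h0, u, ⟨s, hs, t, ht, rfl⟩, hsup, hsum⟩ := F.2
  have h1 : ∀ a, F.1 (Sum.inl a) ≠ 0 → a ∈ s := by
    intro a ha
    have := hsup (show Sum.inl a ∈ Function.support F.1 from ha)
    simpa using this
  have h2 : ∀ b, F.1 (Sum.inr b) ≠ 0 → b ∈ t := by
    intro a ha
    have := hsup (show Sum.inr a ∈ Function.support F.1 from ha)
    simpa using this
  have h3 : wt F = ∑ b ∈ t, F.1 (Sum.inr b) := by
    refine finsum_eq_sum_of_support_subset _ ?_
    intro b hb
    exact h2 b hb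
  refine ⟨s, hs, t, ht, h1, h2, h3, ?_⟩
  rw [Finset.sum_union, Finset.sum_image, Finset.sum_image] at hsum
  · rw [h3]; linarith
  · intro x _ y _ h; exact Sum.inr_injective h
  · intro x _ y _ h; exact Sum.inl_injective h
  · rw [Finset.disjoint_left]
    intro x hx hy
    simp only [Finset.mem_image] at hx hy
    obtain ⟨a, _, rfl⟩ := hx
    obtain ⟨b, _, h⟩ := hy
    cases h

theorem sum_le_wt (F : realization (joinComplex K L)) (t : Finset β) :
    ∑ b ∈ t, F.1 (Sum.inr b) ≤ wt F := by
  obtain ⟨s', -, t', -, -, h2, h3, -⟩ := exists_faces F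
  rw [h3, ← Finset.sum_filter_ne_zero]
  refine Finset.sum_le_sum_of_subset_of_nonneg ?_ (fun b _ _ => F.2.1 _)
  intro b hb
  exact h2 b (Finset.mem_filter.1 hb).2

theorem sum_le_one_sub_wt (F : realization (joinComplex K L)) (s : Finset α) :
    ∑ a ∈ s, F.1 (Sum.inl a) ≤ 1 - wt F := by
  obtain ⟨s', -, t', -, h2, -, -, h3⟩ := exists_faces F
  rw [h3, ← Finset.sum_filter_ne_zero]
  refine Finset.sum_le_sum_of_subset_of_nonneg ?_ (fun b _ _ => F.2.1 _)
  intro b hb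
  exact h2 b (Finset.mem_filter.1 hb).2

theorem wt_nonneg (F : realization (joinComplex K L)) : 0 ≤ wt F := by
  simpa using sum_le_wt F ∅

theorem wt_le_one (F : realization (joinComplex K L)) : wt F ≤ 1 := by
  have := sum_le_one_sub_wt F ∅
  simp at this; linarith

theorem continuous_coord {M : Set (Finset α)} (a : α) :
    Continuous (fun F : realization M => F.1 a) :=
  (continuous_apply a).comp continuous_subtype_val

theorem continuous_wt : Continuous (wt : realization (joinComplex K L) → ℝ) := by
  rw [continuous_iff_continuousAt]
  intro F
  obtain ⟨s, -, t, -, -, -, h3, h4⟩ := exists_faces F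
  have e1 : Tendsto (fun G : realization (joinComplex K L) => ∑ b ∈ t, G.1 (Sum.inr b)) (𝓝 F)
      (𝓝 (wt F)) := by
    rw [h3]
    exact (continuous_finsetSum _ fun b _ => continuous_coord _).tendsto F
  have e2 : Tendsto (fun G : realization (joinComplex K L) => 1 - ∑ a ∈ s, G.1 (Sum.inl a)) (𝓝 F)
      (𝓝 (wt F)) := by
    have : wt F = 1 - ∑ a ∈ s, F.1 (Sum.inl a) := by rw [← h4]; ring
    rw [this]
    exact (continuous_const.sub (continuous_finsetSum _ fun b _ => continuous_coord _)).tendsto F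
  refine tendsto_of_tendsto_of_tendsto_of_le_of_le e1 e2 (fun G => sum_le_wt G t) (fun G => ?_)
  have := sum_le_one_sub_wt G s
  dsimp only; linarith

def left (F : realization (joinComplex K L)) (h : wt F ≠ 1) : realization K :=
  ⟨fun a => (1 - wt F)⁻¹ * F.1 (Sum.inl a), by
    have hp : 0 < 1 - wt F := by
      have := lt_of_le_of_ne (wt_le_one F) h
      linarith
    refine ⟨fun a => mul_nonneg (inv_nonneg.2 hp.le) (F.2.1 _), ?_⟩
    obtain ⟨s, hs, t, ht, h1, h2, h3, h4⟩ := exists_faces F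
    refine ⟨s, hs, ?_, ?_⟩
    · intro a ha
      exact h1 a (right_ne_zero_of_mul ha)
    · rw [← Finset.mul_sum, ← h4]
      exact inv_mul_cancel₀ hp.ne'⟩

def right (F : realization (joinComplex K L)) (h : wt F ≠ 0) : realization L :=
  ⟨fun a => (wt F)⁻¹ * F.1 (Sum.inr a), by
    have hp : 0 < wt F := lt_of_le_of_ne (wt_nonneg F) (Ne.symm h)
    refine ⟨fun a => mul_nonneg (inv_nonneg.2 hp.le) (F.2.1 _), ?_⟩
    obtain ⟨s, hs, t, ht, h1, h2, h3, h4⟩ := exists_faces F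
    refine ⟨t, ht, ?_, ?_⟩
    · intro a ha
      exact h2 a (right_ne_zero_of_mul ha)
    · rw [← Finset.mul_sum, ← h3]
      exact inv_mul_cancel₀ hp.ne'⟩

open Classical in
def leftL (F : realization (joinComplex K L)) : Lft (realization K) :=
  if h : wt F = 1 then Lft.none else Lft.some (left F h)

open Classical in
def rightL (F : realization (joinComplex K L)) : Lft (realization L) :=
  if h : wt F = 0 then Lft.none else Lft.some (right F h)

theorem leftL_none (F : realization (joinComplex K L)) : leftL F = Lft.none ↔ wt F = 1 := by
  unfold leftL; split_ifs with h <;> simp [h, Lft.some_ne_none]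

theorem rightL_none (F : realization (joinComplex K L)) : rightL F = Lft.none ↔ wt F = 0 := by
  unfold rightL; split_ifs with h <;> simp [h, Lft.some_ne_none]

theorem continuous_leftL : Continuous (leftL : realization (joinComplex K L) → _) := by
  refine Lft.continuous_of_open ?_
    (fun F => left F.1 (fun h => F.2 ((leftL_none F.1).2 h))) ?_ ?_
  · simp only [ne_eq, leftL_none]
    exact isOpen_ne.preimage continuous_wt
  · refine Continuous.subtype_mk ?_ _
    refine continuous_pi fun a => ?_
    refine Continuous.mul ?_ ((continuous_coord _).comp continuous_subtype_val)
    refine Continuous.inv₀ (continuous_const.sub (continuous_wt.comp continuous_subtype_val)) ?_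
    intro F h
    exact F.2 ((leftL_none F.1).2 (sub_eq_zero.1 h).symm)
  · intro F
    exact dif_neg (fun h => F.2 ((leftL_none F.1).2 h))

theorem continuous_rightL : Continuous (rightL : realization (joinComplex K L) → _) := by
  refine Lft.continuous_of_open ?_
    (fun F => right F.1 (fun h => F.2 ((rightL_none F.1).2 h))) ?_ ?_
  · simp only [ne_eq, rightL_none]
    exact isOpen_ne.preimage continuous_wt
  · refine Continuous.subtype_mk ?_ _
    refine continuous_pi fun a => ?_
    refine Continuous.mul ?_ ((continuous_coord _).comp continuous_subtype_val)
    refine Continuous.inv₀ (continuous_wt.comp continuous_subtype_val) ?_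
    intro F h
    exact F.2 ((rightL_none F.1).2 h)
  · intro F
    exact dif_neg (fun h => F.2 ((rightL_none F.1).2 h))

theorem mul_val_leftL (F : realization (joinComplex K L)) (a : α) :
    (1 - wt F) * val (leftL F) a = F.1 (Sum.inl a) := by
  unfold leftL
  split_ifs with h
  · have h1 := sum_le_one_sub_wt F {a}
    have h2 := F.2.1 (Sum.inl a)
    simp only [Finset.sum_singleton, h] at h1
    simp only [val_none, mul_zero]
    linarith
  · have : 1 - wt F ≠ 0 := fun h' => h (sub_eq_zero.1 h').symm
    change (1 - wt F) * ((1 - wt F)⁻¹ * F.1 (Sum.inl a)) = _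
    rw [mul_inv_cancel_left₀ this]

theorem mul_val_rightL (F : realization (joinComplex K L)) (b : β) :
    wt F * val (rightL F) b = F.1 (Sum.inr b) := by
  unfold rightL
  split_ifs with h
  · have h1 := sum_le_wt F {b}
    have h2 := F.2.1 (Sum.inr b)
    simp only [Finset.sum_singleton, h] at h1
    simp only [val_none, mul_zero]
    linarith
  · change wt F * ((wt F)⁻¹ * F.1 (Sum.inr b)) = _
    rw [mul_inv_cancel_left₀ h]

def toJoin (F : realization (joinComplex K L)) : CJoin (realization K) (realization L) :=
  ⟨(⟨wt F, wt_nonneg F, wt_le_one F⟩, leftL F, rightL F), by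
    refine ⟨?_, ?_⟩
    · rw [leftL_none, Subtype.ext_iff]; rfl
    · rw [rightL_none, Subtype.ext_iff]; rfl⟩

theorem continuous_toJoin : Continuous (toJoin : realization (joinComplex K L) → _) := by
  refine Continuous.subtype_mk ?_ _
  exact (Continuous.subtype_mk continuous_wt _).prodMk
    (continuous_leftL.prodMk continuous_rightL)

def ofFun (p : CJoin (realization K) (realization L)) : α ⊕ β → ℝ :=
  Sum.elim (fun a => (1 - (p.1.1 : ℝ)) * val p.1.2.1 a) (fun b => (p.1.1 : ℝ) * val p.1.2.2 b)

theorem ofFun_aux (hK : ∅ ∈ K) (hL : ∅ ∈ L) (p : CJoin (realization K) (realization L)) :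
    ∃ s ∈ K, ∃ t ∈ L, Function.support (ofFun p) ⊆ ↑(s.image Sum.inl ∪ t.image Sum.inr) ∧
      ∑ x ∈ (s.image Sum.inl ∪ t.image Sum.inr), ofFun p x = 1 ∧
      Function.support (fun b => ofFun p (Sum.inr b)) ⊆ ↑t ∧
      ∑ b ∈ t, ofFun p (Sum.inr b) = p.1.1 := by
  obtain ⟨s, hs, hs1, hs2⟩ := val_supp hK p.1.2.1
  obtain ⟨t, ht, ht1, ht2⟩ := val_supp hL p.1.2.2
  have e1 : ∑ b ∈ t, ofFun p (Sum.inr b) = p.1.1 := by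
    simp only [ofFun, Sum.elim_inr, ← Finset.mul_sum]
    by_cases h : p.1.2.2 = Lft.none
    · rw [p.2.2.1 h]; simp
    · rw [ht2 h, mul_one]
  have e2 : ∑ a ∈ s, ofFun p (Sum.inl a) = 1 - p.1.1 := by
    simp only [ofFun, Sum.elim_inl, ← Finset.mul_sum]
    by_cases h : p.1.2.1 = Lft.none
    · rw [p.2.1.1 h]; simp
    · rw [hs2 h, mul_one]
  refine ⟨s, hs, t, ht, ?_, ?_, ?_, e1⟩
  · rintro (a | b) h
    · simpa using hs1 (right_ne_zero_of_mul (show (1 - (p.1.1 : ℝ)) * val p.1.2.1 a ≠ 0 from h))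
    · simpa using ht1 (right_ne_zero_of_mul (show (p.1.1 : ℝ) * val p.1.2.2 b ≠ 0 from h))
  · rw [Finset.sum_union, Finset.sum_image, Finset.sum_image, e1, e2]
    · ring
    · intro x _ y _ h; exact Sum.inr_injective h
    · intro x _ y _ h; exact Sum.inl_injective h
    · rw [Finset.disjoint_left]
      intro x hx hy
      simp only [Finset.mem_image] at hx hy
      obtain ⟨a, _, rfl⟩ := hx
      obtain ⟨b, _, h⟩ := hy
      cases h
  · intro b h
    exact ht1 (right_ne_zero_of_mul (show (p.1.1 : ℝ) * val p.1.2.2 b ≠ 0 from h))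

def ofJoin (hK : ∅ ∈ K) (hL : ∅ ∈ L) (p : CJoin (realization K) (realization L)) :
    realization (joinComplex K L) :=
  ⟨ofFun p, by
    refine ⟨?_, ?_⟩
    · rintro (a | b)
      · exact mul_nonneg (sub_nonneg.2 p.1.1.2.2) (val_nonneg _ _)
      · exact mul_nonneg p.1.1.2.1 (val_nonneg _ _)
    · obtain ⟨s, hs, t, ht, h1, h2, -, -⟩ := ofFun_aux hK hL p
      exact ⟨_, ⟨s, hs, t, ht, rfl⟩, h1, h2⟩⟩

theorem continuousAt_val (a : α) (z : Lft (realization K)) (hz : z ≠ Lft.none) :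
    ContinuousAt (fun z : Lft (realization K) => val z a) z := by
  rcases Lft.cases' z with rfl | ⟨f, rfl⟩
  · exact absurd rfl hz
  · refine (Lft.isOpenEmbedding_some.continuousAt_iff (x := f)).1 ?_
    exact (continuous_coord a).continuousAt

theorem continuous_mul_val {Z : Type*} [TopologicalSpace Z] (r : Z → ℝ)
    (z : Z → Lft (realization K)) (hr : Continuous r) (hz : Continuous z)
    (h : ∀ p, z p = Lft.none → r p = 0) (a : α) : Continuous (fun p => r p * val (z p) a) := by
  rw [continuous_iff_continuousAt]
  intro p
  by_cases hp : z p = Lft.none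
  · have h0 : r p * val (z p) a = 0 := by rw [h p hp, zero_mul]
    have : Tendsto (fun q => |r q|) (𝓝 p) (𝓝 0) := by
      have := hr.abs.tendsto p
      rwa [h p hp, abs_zero] at this
    unfold ContinuousAt
    dsimp only
    rw [h0]
    refine squeeze_zero_norm (fun q => ?_) this
    rw [Real.norm_eq_abs, abs_mul, abs_of_nonneg (val_nonneg (z q) a)]
    exact mul_le_of_le_one_right (abs_nonneg _) (val_le_one _ _)
  · exact hr.continuousAt.mul
      (ContinuousAt.comp (g := fun z : Lft (realization K) => val z a)
        (continuousAt_val a (z p) hp) hz.continuousAt)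

theorem continuous_ofJoin (hK : ∅ ∈ K) (hL : ∅ ∈ L) :
    Continuous (ofJoin hK hL) := by
  have h0 : Continuous (fun p : CJoin (realization K) (realization L) => p.1) :=
    continuous_subtype_val
  have ht : Continuous (fun p : CJoin (realization K) (realization L) => (p.1.1 : ℝ)) :=
    continuous_subtype_val.comp (continuous_fst.comp h0)
  refine Continuous.subtype_mk ?_ _
  refine continuous_pi ?_
  rintro (a | b)
  · refine continuous_mul_val _ _ (continuous_const.sub ht)
      (continuous_fst.comp (continuous_snd.comp h0)) ?_ a
    intro p hp
    rw [Function.comp_apply, Function.comp_apply] at hp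
    change 1 - (p.1.1 : ℝ) = 0
    rw [p.2.1.1 hp]; simp
  · refine continuous_mul_val _ _ ht
      (continuous_snd.comp (continuous_snd.comp h0)) ?_ b
    intro p hp
    rw [Function.comp_apply, Function.comp_apply] at hp
    rw [p.2.2.1 hp]; simp

theorem wt_ofJoin (hK : ∅ ∈ K) (hL : ∅ ∈ L) (p : CJoin (realization K) (realization L)) :
    wt (ofJoin hK hL p) = p.1.1 := by
  obtain ⟨s, hs, t, ht, -, -, h3, h4⟩ := ofFun_aux hK hL p
  rw [← h4]
  exact finsum_eq_sum_of_support_subset _ h3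

def homeo (hK : ∅ ∈ K) (hL : ∅ ∈ L) :
    realization (joinComplex K L) ≃ₜ CJoin (realization K) (realization L) where
  toFun := toJoin
  invFun := ofJoin hK hL
  left_inv F := by
    apply Subtype.ext
    funext x
    rcases x with a | b
    · exact mul_val_leftL F a
    · exact mul_val_rightL F b
  right_inv p := by
    have hw := wt_ofJoin hK hL p
    apply CJoin.ext'
    · exact Subtype.ext hw
    · change leftL (ofJoin hK hL p) = p.1.2.1
      rcases Lft.cases' p.1.2.1 with h | ⟨f, h⟩
      · rw [h, leftL_none, hw, p.2.1.1 h]; rfl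
      · have h1 : p.1.1 ≠ 1 := fun h' => by
          rw [p.2.1.2 h'] at h; exact Lft.none_ne_some _ h
        have h2 : (p.1.1 : ℝ) ≠ 1 := fun h' => h1 (Subtype.ext h')
        have h3 : wt (ofJoin hK hL p) ≠ 1 := by rwa [hw]
        rw [leftL, dif_neg h3, h]
        congr 1
        apply Subtype.ext
        funext a
        change (1 - wt (ofJoin hK hL p))⁻¹ * ((1 - (p.1.1 : ℝ)) * val p.1.2.1 a) = f.1 a
        rw [hw, h, val_some, inv_mul_cancel_left₀ (sub_ne_zero.2 h2.symm)]
    · change rightL (ofJoin hK hL p) = p.1.2.2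
      rcases Lft.cases' p.1.2.2 with h | ⟨f, h⟩
      · rw [h, rightL_none, hw, p.2.2.1 h]; rfl
      · have h1 : p.1.1 ≠ 0 := fun h' => by
          rw [p.2.2.2 h'] at h; exact Lft.none_ne_some _ h
        have h2 : (p.1.1 : ℝ) ≠ 0 := fun h' => h1 (Subtype.ext h')
        have h3 : wt (ofJoin hK hL p) ≠ 0 := by rwa [hw]
        rw [rightL, dif_neg h3, h]
        congr 1
        apply Subtype.ext
        funext a
        change (wt (ofJoin hK hL p))⁻¹ * ((p.1.1 : ℝ) * val p.1.2.2 a) = f.1 a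
        rw [hw, h, val_some, inv_mul_cancel_left₀ h2]
  continuous_toFun := continuous_toJoin
  continuous_invFun := continuous_ofJoin hK hL

end RealJoin

/-! ### Collapsing a contractible subspace of the join of two well-pointed spaces -/

theorem descend {A B Z : Type*} [TopologicalSpace A] [TopologicalSpace B] [TopologicalSpace Z]
    [CompactSpace A] [T2Space B] {q : A → B} (hq : Continuous q) (hs : Function.Surjective q)
    {φ : A → Z} (hφ : Continuous φ) (h : ∀ a a', q a = q a' → φ a = φ a') :
    ∃ ψ : B → Z, Continuous ψ ∧ ∀ a, ψ (q a) = φ a := by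
  have hQ : IsQuotientMap q := IsQuotientMap.of_surjective_continuous hs hq
  choose g hg using hs
  have e : ∀ a, φ (g (q a)) = φ a := fun a => h _ _ (hg _)
  refine ⟨φ ∘ g, ?_, e⟩
  rw [hQ.continuous_iff]
  have : (φ ∘ g) ∘ q = φ := funext e
  rwa [this]

open Classical in
/-- collapse the complement of an open subspace to infinity -/
def collapse {W P : Type*} (j : W → P) (p : P) : OnePoint W :=
  if h : ∃ w, j w = p then OnePoint.some h.choose else OnePoint.infty

theorem collapse_apply {W P : Type*} {j : W → P} (hj : Function.Injective j) (w : W) :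
    collapse j (j w) = OnePoint.some w := by
  have h : ∃ w', j w' = j w := ⟨w, rfl⟩
  rw [collapse, dif_pos h]
  congr 1
  exact hj h.choose_spec

theorem collapse_infty {W P : Type*} {j : W → P} {p : P} (h : ¬ ∃ w, j w = p) :
    collapse j p = OnePoint.infty := dif_neg h

theorem collapse_eq_infty_iff {W P : Type*} {j : W → P} {p : P} :
    collapse j p = OnePoint.infty ↔ ¬ ∃ w, j w = p := by
  refine ⟨fun h h' => ?_, collapse_infty⟩
  rw [collapse, dif_pos h'] at h
  exact OnePoint.coe_ne_infty _ h

theorem continuous_collapse {W P : Type*} [TopologicalSpace W] [TopologicalSpace P] [T2Space P]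
    {j : W → P} (hj : IsOpenEmbedding j) : Continuous (collapse j) := by
  rw [continuous_def]
  intro s hs
  by_cases hi : OnePoint.infty ∈ s
  · rw [OnePoint.isOpen_iff_of_mem hi] at hs
    have : collapse j ⁻¹' s = (j '' ((OnePoint.some ⁻¹' s : Set W)ᶜ))ᶜ := by
      ext p
      by_cases hp : ∃ w, j w = p
      · obtain ⟨w, rfl⟩ := hp
        simp [collapse_apply hj.injective, hj.injective.eq_iff]
      · simp only [mem_preimage, collapse_infty hp, hi, mem_compl_iff, mem_image, true_iff]
        rintro ⟨w, _, h⟩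
        exact hp ⟨w, h⟩
    rw [this]
    exact (hs.2.image hj.continuous).isClosed.isOpen_compl
  · rw [OnePoint.isOpen_iff_of_notMem hi] at hs
    have : collapse j ⁻¹' s = j '' (OnePoint.some ⁻¹' s : Set W) := by
      ext p
      by_cases hp : ∃ w, j w = p
      · obtain ⟨w, rfl⟩ := hp
        simp [collapse_apply hj.injective, hj.injective.eq_iff]
      · simp only [mem_preimage, collapse_infty hp, hi, mem_image, false_iff]
        rintro ⟨w, _, h⟩
        exact hp ⟨w, h⟩
    rw [this]
    exact hj.isOpenMap _ hs

/-- A deformation of a neighbourhood of the base point into the base point. -/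
structure WellPt (X : Type*) [TopologicalSpace X] (x0 : X) where
  D : X × I → X
  cont : Continuous D
  zero : ∀ x, D (x, 0) = x
  base : ∀ s, D (x0, s) = x0
  lam : X → ℝ
  lam_cont : Continuous lam
  lam_base : lam x0 = 1
  lam_one : ∀ x, lam x ≠ 0 → D (x, 1) = x0

namespace CJoin

variable {X Y : Type*} [TopologicalSpace X] [TopologicalSpace Y]

open Classical in
def mk (p : X × Y × I) : CJoin X Y :=
  ⟨(p.2.2, if p.2.2 = 1 then Lft.none else Lft.some p.1,
    if p.2.2 = 0 then Lft.none else Lft.some p.2.1), by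
    constructor
    · dsimp only; split_ifs with h <;> simp [h, Lft.some_ne_none]
    · dsimp only; split_ifs with h <;> simp [h, Lft.some_ne_none]⟩

theorem continuous_mk : Continuous (mk : X × Y × I → CJoin X Y) := by
  have ht : Continuous (fun p : X × Y × I => p.2.2) := by fun_prop
  refine Continuous.subtype_mk (ht.prodMk (Continuous.prodMk ?_ ?_)) _
  · rw [continuous_iff_continuousAt]
    intro p
    by_cases h : p.2.2 = 1
    · exact Lft.continuousAt_none (if_pos h)
    · have : ∀ᶠ q in 𝓝 p, q.2.2 ≠ 1 := (isOpen_ne.preimage ht).mem_nhds h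
      refine (Lft.isOpenEmbedding_some.continuous.comp continuous_fst).continuousAt.congr ?_
      filter_upwards [this] with q hq
      rw [if_neg hq]; rfl
  · rw [continuous_iff_continuousAt]
    intro p
    by_cases h : p.2.2 = 0
    · exact Lft.continuousAt_none (if_pos h)
    · have : ∀ᶠ q in 𝓝 p, q.2.2 ≠ 0 := (isOpen_ne.preimage ht).mem_nhds h
      refine (Lft.isOpenEmbedding_some.continuous.comp
        (continuous_fst.comp continuous_snd)).continuousAt.congr ?_
      filter_upwards [this] with q hq
      rw [if_neg hq]; rfl

theorem mk_surjective (x0 : X) (y0 : Y) : Function.Surjective (mk : X × Y × I → CJoin X Y) := by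
  intro p
  have hx : ∃ x, p.1.1 ≠ 1 → p.1.2.1 = Lft.some x := by
    rcases Lft.cases' p.1.2.1 with h | ⟨x, h⟩
    · exact ⟨x0, fun h' => absurd (p.2.1.1 h) h'⟩
    · exact ⟨x, fun _ => h⟩
  have hy : ∃ x, p.1.1 ≠ 0 → p.1.2.2 = Lft.some x := by
    rcases Lft.cases' p.1.2.2 with h | ⟨x, h⟩
    · exact ⟨y0, fun h' => absurd (p.2.2.1 h) h'⟩
    · exact ⟨x, fun _ => h⟩
  obtain ⟨x, hx⟩ := hx
  obtain ⟨y, hy⟩ := hy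
  refine ⟨(x, y, p.1.1), ?_⟩
  apply ext'
  · rfl
  · simp only [mk]
    split_ifs with h
    · exact (p.2.1.2 h).symm
    · exact (hx h).symm
  · simp only [mk]
    split_ifs with h
    · exact (p.2.2.2 h).symm
    · exact (hy h).symm

theorem mk_eq {x x' : X} {y y' : Y} {t t' : I} :
    mk (x, y, t) = mk (x', y', t') ↔ t = t' ∧ (t ≠ 1 → x = x') ∧ (t ≠ 0 → y = y') := by
  constructor
  · intro h
    have h1 : t = t' := congrArg (fun p => p.1.1) h
    have h2 := congrArg (fun p : CJoin X Y => p.1.2.1) h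
    have h3 := congrArg (fun p : CJoin X Y => p.1.2.2) h
    subst h1
    refine ⟨rfl, fun ht => ?_, fun ht => ?_⟩
    · simpa [mk, ht, Lft.some_inj] using h2
    · simpa [mk, ht, Lft.some_inj] using h3
  · rintro ⟨rfl, h2, h3⟩
    apply ext'
    · rfl
    · simp only [mk]
      split_ifs with h
      · rfl
      · rw [h2 h]
    · simp only [mk]
      split_ifs with h
      · rfl
      · rw [h3 h]

instance [T2Space X] [T2Space Y] : T2Space (CJoin X Y) := by
  refine ⟨fun p q hpq => ?_⟩
  have c1 : Continuous fun p : CJoin X Y => p.1.1 := continuous_fst.comp continuous_subtype_val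
  have c2 : Continuous fun p : CJoin X Y => p.1.2.1 :=
    (continuous_fst.comp continuous_snd).comp continuous_subtype_val
  have c3 : Continuous fun p : CJoin X Y => p.1.2.2 :=
    (continuous_snd.comp continuous_snd).comp continuous_subtype_val
  by_cases h1 : p.1.1 = q.1.1
  · by_cases h2 : p.1.2.1 = q.1.2.1
    · have h3 : p.1.2.2 ≠ q.1.2.2 := fun h3 => hpq (ext' h1 h2 h3)
      rcases Lft.cases' p.1.2.2 with hp | ⟨x, hp⟩
      · exact absurd (hp.trans (q.2.2.2 (h1 ▸ p.2.2.1 hp)).symm) h3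
      rcases Lft.cases' q.1.2.2 with hq | ⟨x', hq⟩
      · exact absurd ((p.2.2.2 (h1.trans (q.2.2.1 hq))).trans hq.symm) h3
      have hne : x ≠ x' := fun h => h3 (by rw [hp, hq, h])
      obtain ⟨u, v, hu, hv, hx, hy, hd⟩ := Lft.separated hne
      refine ⟨_, _, hu.preimage c3, hv.preimage c3, ?_, ?_, hd.preimage _⟩
      · rwa [mem_preimage, hp]
      · rwa [mem_preimage, hq]
    · rcases Lft.cases' p.1.2.1 with hp | ⟨x, hp⟩
      · exact absurd (hp.trans (q.2.1.2 (h1 ▸ p.2.1.1 hp)).symm) h2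
      rcases Lft.cases' q.1.2.1 with hq | ⟨x', hq⟩
      · exact absurd ((p.2.1.2 (h1.trans (q.2.1.1 hq))).trans hq.symm) h2
      have hne : x ≠ x' := fun h => h2 (by rw [hp, hq, h])
      obtain ⟨u, v, hu, hv, hx, hy, hd⟩ := Lft.separated hne
      refine ⟨_, _, hu.preimage c2, hv.preimage c2, ?_, ?_, hd.preimage _⟩
      · rwa [mem_preimage, hp]
      · rwa [mem_preimage, hq]
  · obtain ⟨u, v, hu, hv, hx, hy, hd⟩ := t2_separation h1
    exact ⟨_, _, hu.preimage c1, hv.preimage c1, hx, hy, hd.preimage _⟩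

theorem swap_mk (x : X) (y : Y) (t : I) : swap (mk (x, y, t)) = mk (y, x, σ t) := by
  apply ext'
  · rfl
  · simp [swap, mk]
  · simp [swap, mk]

/-- maps preserving both coordinate subspaces of the join -/
def Pres (x0 : X) (y0 : Y) (f : C(CJoin X Y, CJoin X Y)) : Prop :=
  (∀ y t, ∃ y' t', f (mk (x0, y, t)) = mk (x0, y', t')) ∧
  (∀ x t, ∃ x' t', f (mk (x, y0, t)) = mk (x', y0, t'))

def mkR (x : X) (y : Y) (r : ℝ) : CJoin X Y := mk (x, y, projIcc 0 1 zero_le_one r)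

theorem mkR_ge (x x' : X) (y : Y) {r : ℝ} (h : 1 ≤ r) : mkR x y r = mkR x' y r := by
  rw [mkR, mkR, projIcc_of_right_le _ h, mk_eq]
  exact ⟨rfl, fun h => absurd rfl h, fun _ => rfl⟩

theorem mkR_le (x : X) (y y' : Y) {r : ℝ} (h : r ≤ 0) : mkR x y r = mkR x y' r := by
  rw [mkR, mkR, projIcc_of_le_left _ h, mk_eq]
  exact ⟨rfl, fun _ => rfl, fun h => absurd rfl h⟩

theorem mkR_coe (x : X) (y : Y) (t : I) : mkR x y t = mk (x, y, t) := by
  rw [mkR, projIcc_val]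

theorem continuous_mkR : Continuous (fun p : X × Y × ℝ => mkR p.1 p.2.1 p.2.2) :=
  continuous_mk.comp (continuous_fst.prodMk ((continuous_fst.comp continuous_snd).prodMk
    (continuous_projIcc.comp (continuous_snd.comp continuous_snd))))

/-- clamped real parameter -/
def cl (r : ℝ) : ℝ := max 0 (min 1 r)

theorem continuous_cl : Continuous cl := by unfold cl; fun_prop

theorem cl_of_le {r : ℝ} (h : r ≤ 0) : cl r = 0 := by
  unfold cl; rw [min_eq_right (by linarith), max_eq_left h]

theorem cl_of_ge {r : ℝ} (h : 1 ≤ r) : cl r = 1 := by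
  unfold cl; rw [min_eq_left h, max_eq_right zero_le_one]

theorem cl_nonneg (r : ℝ) : 0 ≤ cl r := le_max_left _ _

variable [CompactSpace X] [CompactSpace Y] [T2Space X] [T2Space Y]

open Classical in
theorem stage {x0 : X} (w : WellPt X x0) (y0 : Y) :
    ∃ f : C(CJoin X Y, CJoin X Y),
      (ContinuousMap.id _).HomotopicWith f (Pres x0 y0) ∧
      ∀ y t, f (mk (x0, y, t)) = mk (x0, y0, 0) := by
  let dd : I → I := fun s => projIcc 0 1 zero_le_one (3 * (s : ℝ))
  let aa : I → ℝ := fun s => cl (3 * (s : ℝ) - 1)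
  let bb : I → ℝ := fun s => cl (3 * (s : ℝ) - 2)
  have hdd : Continuous dd := continuous_projIcc.comp (by fun_prop)
  have haa : Continuous aa := continuous_cl.comp (by fun_prop)
  have hbb : Continuous bb := continuous_cl.comp (by fun_prop)
  have hb0 : ∀ s, bb s ≠ 0 → aa s = 1 ∧ dd s = 1 := by
    intro s hs
    have : (2 : ℝ) < 3 * s := by
      by_contra h
      exact hs (cl_of_le (by linarith))
    exact ⟨cl_of_ge (by linarith), projIcc_of_right_le _ (by linarith)⟩
  let Φ : I × (X × Y × I) → CJoin X Y := fun p =>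
    if (1 + aa p.1) * (p.2.2.2 : ℝ) ≤ 1 then
      mkR (w.D (p.2.1, dd p.1)) p.2.2.1
        ((1 - w.lam p.2.1 * bb p.1) * ((1 + aa p.1) * (p.2.2.2 : ℝ)))
    else mkR x0 p.2.2.1 ((1 - w.lam p.2.1 * bb p.1) * (2 - (1 + aa p.1) * (p.2.2.2 : ℝ)))
  have hlam := w.lam_cont
  have hD := w.cont
  have hΦ : Continuous Φ := by
    refine Continuous.if_le ?_ ?_ (by fun_prop) continuous_const ?_
    · exact continuous_mkR.comp (f := fun p : I × (X × Y × I) => (w.D (p.2.1, dd p.1), p.2.2.1,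
        ((1 - w.lam p.2.1 * bb p.1) * ((1 + aa p.1) * (p.2.2.2 : ℝ))))) (by fun_prop)
    · exact continuous_mkR.comp (f := fun p : I × (X × Y × I) => (x0, p.2.2.1,
        ((1 - w.lam p.2.1 * bb p.1) * (2 - (1 + aa p.1) * (p.2.2.2 : ℝ))))) (by fun_prop)
    · intro p hp
      rw [hp]
      have e : (2 : ℝ) - 1 = 1 := by norm_num
      rw [e, mul_one]
      by_cases h : w.lam p.2.1 * bb p.1 = 0
      · rw [h]; exact mkR_ge _ _ _ (by norm_num)
      · have h1 := left_ne_zero_of_mul h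
        have h2 := hb0 _ (right_ne_zero_of_mul h)
        rw [h2.2, w.lam_one _ h1]
  have hΦ0 : ∀ s x y y', Φ (s, (x, y, 0)) = Φ (s, (x, y', 0)) := by
    intro s x y y'
    simp only [Φ]
    have e : (1 + aa s) * ((0 : I) : ℝ) = 0 := by simp
    rw [e, if_pos zero_le_one, if_pos zero_le_one]
    exact mkR_le _ _ _ (by simp)
  have hΦ1 : ∀ s x x' y, Φ (s, (x, y, 1)) = Φ (s, (x', y, 1)) := by
    intro s x x' y
    simp only [Φ]
    have e : (1 + aa s) * ((1 : I) : ℝ) = 1 + aa s := by simp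
    rw [e]
    by_cases hb : bb s = 0
    · simp only [hb, mul_zero, sub_zero, one_mul]
      split_ifs with h
      · exact mkR_ge _ _ _ (by have := cl_nonneg (3 * (s : ℝ) - 1); simp only [aa]; linarith)
      · rfl
    · rw [(hb0 s hb).1]
      norm_num
  obtain ⟨Ψ, hΨ, hΨΦ⟩ := descend (A := I × (X × Y × I)) (B := I × CJoin X Y)
    (q := Prod.map id mk) (continuous_id.prodMap continuous_mk)
    (Function.surjective_id.prodMap (mk_surjective x0 y0)) hΦ (by
      rintro ⟨s, x, y, t⟩ ⟨s', x', y', t'⟩ h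
      simp only [Prod.map_apply, id_eq, Prod.mk.injEq] at h
      obtain ⟨rfl, h⟩ := h
      rw [mk_eq] at h
      obtain ⟨rfl, h1, h2⟩ := h
      by_cases ht0 : t = 0
      · subst ht0
        obtain rfl := h1 zero_ne_one
        exact hΦ0 _ _ _ _
      · obtain rfl := h2 ht0
        by_cases ht1 : t = 1
        · subst ht1
          exact hΦ1 _ _ _ _
        · obtain rfl := h1 ht1
          rfl)
  have key : ∀ s x y t, Ψ (s, mk (x, y, t)) = Φ (s, (x, y, t)) := fun s x y t =>
    hΨΦ (s, (x, y, t))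
  refine ⟨⟨fun p => Ψ (1, p), hΨ.comp (by fun_prop)⟩, ⟨⟨⟨⟨Ψ, hΨ⟩, ?_, ?_⟩, ?_⟩⟩, ?_⟩
  · intro p
    obtain ⟨⟨x, y, t⟩, rfl⟩ := mk_surjective x0 y0 p
    change Ψ (0, mk (x, y, t)) = mk (x, y, t)
    rw [key]
    have e1 : aa 0 = 0 := cl_of_le (by norm_num)
    have e2 : bb 0 = 0 := cl_of_le (by norm_num)
    have e3 : dd 0 = 0 := projIcc_of_le_left _ (by norm_num)
    simp only [Φ, e1, e2, e3, add_zero, one_mul, mul_zero, sub_zero, if_pos t.2.2, w.zero]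
    exact mkR_coe _ _ _
  · intro p
    rfl
  · intro s
    constructor
    · intro y t
      change ∃ y' t', Ψ (s, mk (x0, y, t)) = _
      rw [key]
      simp only [Φ, w.base]
      split_ifs
      · exact ⟨_, _, rfl⟩
      · exact ⟨_, _, rfl⟩
    · intro x t
      change ∃ y' t', Ψ (s, mk (x, y0, t)) = _
      rw [key]
      simp only [Φ]
      split_ifs
      · exact ⟨_, _, rfl⟩
      · exact ⟨_, _, rfl⟩
  · intro y t
    change Ψ (1, mk (x0, y, t)) = _
    rw [key]
    have e2 : bb 1 = 1 := cl_of_ge (by norm_num)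
    have e0 : mk (x0, y0, 0) = mkR x0 y0 0 := (mkR_coe x0 y0 0).symm
    simp only [Φ, e2, w.base, w.lam_base, mul_one, sub_self, zero_mul, ite_self]
    rw [e0]
    exact mkR_le _ _ _ le_rfl

theorem stage' (x0 : X) {y0 : Y} (w : WellPt Y y0) :
    ∃ f : C(CJoin X Y, CJoin X Y),
      (ContinuousMap.id _).HomotopicWith f (Pres x0 y0) ∧
      ∀ x t, f (mk (x, y0, t)) = mk (x0, y0, 1) := by
  obtain ⟨f, ⟨F⟩, hf⟩ := stage w x0
  let sw : C(CJoin X Y, CJoin Y X) := ⟨swap, continuous_swap⟩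
  let sw' : C(CJoin Y X, CJoin X Y) := ⟨swap, continuous_swap⟩
  have hss : ∀ p : CJoin X Y, swap (swap p) = p := swapHomeo.left_inv
  refine ⟨sw'.comp (f.comp sw), ⟨⟨⟨⟨fun p => swap (F (p.1, swap p.2)), ?_⟩, ?_, ?_⟩, ?_⟩⟩, ?_⟩
  · exact continuous_swap.comp (F.continuous.comp
      (continuous_fst.prodMk (continuous_swap.comp continuous_snd)))
  · intro p
    change swap (F (0, swap p)) = p
    rw [F.apply_zero]
    exact hss p
  · intro p
    change swap (F (1, swap p)) = swap (f (swap p))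
    rw [F.apply_one]
  · intro s
    have hP := F.prop s
    constructor
    · intro y t
      obtain ⟨x', t', h⟩ := hP.2 y (σ t)
      have h' : F (s, mk (y, x0, σ t)) = mk (x', x0, t') := h
      refine ⟨x', σ t', ?_⟩
      change swap (F (s, swap (mk (x0, y, t)))) = _
      rw [swap_mk, h', swap_mk]
    · intro x t
      obtain ⟨x', t', h⟩ := hP.1 x (σ t)
      have h' : F (s, mk (y0, x, σ t)) = mk (y0, x', t') := h
      refine ⟨x', σ t', ?_⟩
      change swap (F (s, swap (mk (x, y0, t)))) = _
      rw [swap_mk, h', swap_mk]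
  · intro x t
    change swap (f (swap (mk (x, y0, t)))) = _
    rw [swap_mk, hf, swap_mk]
    simp

theorem both {x0 : X} {y0 : Y} (w : WellPt X x0) (w' : WellPt Y y0) :
    ∃ f : C(CJoin X Y, CJoin X Y),
      (ContinuousMap.id _).HomotopicWith f (Pres x0 y0) ∧
      (∀ y t, f (mk (x0, y, t)) = mk (x0, y0, 1)) ∧
      (∀ x t, f (mk (x, y0, t)) = mk (x0, y0, 1)) := by
  obtain ⟨f, hF, hf⟩ := stage (Y := Y) w y0
  obtain ⟨g, ⟨G⟩, hg⟩ := stage' (X := X) x0 w'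
  have hfP : Pres x0 y0 f := by
    obtain ⟨F⟩ := hF
    have := F.prop 1
    convert this using 1
    ext p
    exact (F.apply_one p).symm
  refine ⟨g.comp f, hF.trans ⟨⟨⟨⟨fun p => G (p.1, f p.2), ?_⟩, ?_, ?_⟩, ?_⟩⟩, ?_, ?_⟩
  · exact G.continuous.comp (by fun_prop)
  · intro p
    change G (0, f p) = f p
    rw [G.apply_zero]; rfl
  · intro p
    change G (1, f p) = g (f p)
    rw [G.apply_one]
  · intro s
    have hP := G.prop s
    constructor
    · intro y t
      obtain ⟨y', t', h⟩ := hfP.1 y t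
      change ∃ y'' t'', G (s, f (mk (x0, y, t))) = _
      rw [h]
      exact hP.1 y' t'
    · intro x t
      obtain ⟨x', t', h⟩ := hfP.2 x t
      change ∃ y'' t'', G (s, f (mk (x, y0, t))) = _
      rw [h]
      exact hP.2 x' t'
  · intro y t
    change g (f _) = _
    rw [hf, hg]
  · intro x t
    obtain ⟨x', t', h⟩ := hfP.2 x t
    change g (f _) = _
    rw [h, hg]

/-- The open cell part of the join. -/
abbrev Cell (x0 : X) (y0 : Y) : Type _ :=
  {x : X // x ≠ x0} × {y : Y // y ≠ y0} × {t : I // t ≠ 0 ∧ t ≠ 1}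

theorem collapse_hequiv {x0 : X} {y0 : Y} (w : WellPt X x0) (w' : WellPt Y y0) :
    Nonempty (ContinuousMap.HomotopyEquiv (CJoin X Y) (OnePoint (Cell x0 y0))) := by
  let j : Cell x0 y0 → X × Y × I := Prod.map Subtype.val (Prod.map Subtype.val Subtype.val)
  have hI : IsOpen {t : I | t ≠ 0 ∧ t ≠ 1} := isOpen_ne.inter isOpen_ne
  have hj : IsOpenEmbedding j :=
    (isOpen_ne.isOpenEmbedding_subtypeVal).prodMap
      ((isOpen_ne.isOpenEmbedding_subtypeVal).prodMap hI.isOpenEmbedding_subtypeVal)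
  have hjr : ∀ x y t, (∃ c, j c = (x, y, t)) ↔ x ≠ x0 ∧ y ≠ y0 ∧ t ≠ 0 ∧ t ≠ 1 := by
    intro x y t
    constructor
    · rintro ⟨⟨⟨x', hx⟩, ⟨y', hy⟩, ⟨t', ht⟩⟩, h⟩
      simp only [j, Prod.map_apply, Prod.mk.injEq] at h
      obtain ⟨rfl, rfl, rfl⟩ := h
      exact ⟨hx, hy, ht⟩
    · rintro ⟨hx, hy, ht⟩
      exact ⟨⟨⟨x, hx⟩, ⟨y, hy⟩, ⟨t, ht⟩⟩, rfl⟩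
  haveI : LocallyCompactSpace {x : X // x ≠ x0} :=
    (isOpen_ne.isOpenEmbedding_subtypeVal).locallyCompactSpace
  haveI : LocallyCompactSpace {y : Y // y ≠ y0} :=
    (isOpen_ne.isOpenEmbedding_subtypeVal).locallyCompactSpace
  haveI : LocallyCompactSpace {t : I // t ≠ 0 ∧ t ≠ 1} :=
    hI.isOpenEmbedding_subtypeVal.locallyCompactSpace
  obtain ⟨q, hq, hqc⟩ := descend (A := X × Y × I) (B := CJoin X Y) continuous_mk
    (mk_surjective x0 y0) (continuous_collapse hj) (by
      rintro ⟨x, y, t⟩ ⟨x', y', t'⟩ h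
      rw [mk_eq] at h
      obtain ⟨rfl, h1, h2⟩ := h
      by_cases ht : t ≠ 0 ∧ t ≠ 1
      · rw [h1 ht.2, h2 ht.1]
      · rw [collapse_infty, collapse_infty]
        · rw [hjr]; tauto
        · rw [hjr]; tauto)
  have hqs : Function.Surjective q := by
    intro z
    induction z using OnePoint.rec with
    | infty =>
      refine ⟨mk (x0, y0, 0), ?_⟩
      rw [hqc, collapse_infty]
      rw [hjr]; tauto
    | coe c => exact ⟨mk (j c), by rw [hqc, collapse_apply hj.injective]⟩
  haveI : CompactSpace (CJoin X Y) := by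
    refine ⟨?_⟩
    rw [← (mk_surjective x0 y0).range_eq]
    exact isCompact_range continuous_mk
  -- the collapsed subspace
  have hinf : ∀ p, q p = OnePoint.infty →
      (∃ y t, p = mk (x0, y, t)) ∨ (∃ x t, p = mk (x, y0, t)) := by
    intro p hp
    obtain ⟨⟨x, y, t⟩, rfl⟩ := mk_surjective x0 y0 p
    rw [hqc, collapse_eq_infty_iff, hjr] at hp
    by_cases hx : x = x0
    · exact Or.inl ⟨y, t, by rw [hx]⟩
    by_cases hy : y = y0
    · exact Or.inr ⟨x, t, by rw [hy]⟩
    by_cases ht : t = 0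
    · refine Or.inr ⟨x, t, ?_⟩
      rw [mk_eq]
      exact ⟨rfl, fun _ => rfl, fun h => absurd ht h⟩
    · have ht1 : t = 1 := by tauto
      refine Or.inl ⟨y, t, ?_⟩
      rw [mk_eq]
      exact ⟨rfl, fun h => absurd ht1 h, fun _ => rfl⟩
  have hinf1 : ∀ y t, q (mk (x0, y, t)) = OnePoint.infty := by
    intro y t
    rw [hqc, collapse_eq_infty_iff, hjr]; tauto
  have hinf2 : ∀ x t, q (mk (x, y0, t)) = OnePoint.infty := by
    intro y t
    rw [hqc, collapse_eq_infty_iff, hjr]; tauto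
  have hfib : ∀ p p', q p = q p' → p = p' ∨ (q p = OnePoint.infty ∧ q p' = OnePoint.infty) := by
    intro p p' h
    by_cases hp : q p = OnePoint.infty
    · exact Or.inr ⟨hp, h ▸ hp⟩
    · left
      have hp' : q p' ≠ OnePoint.infty := h ▸ hp
      obtain ⟨c, rfl⟩ := mk_surjective x0 y0 p
      obtain ⟨c', rfl⟩ := mk_surjective x0 y0 p'
      rw [hqc] at hp hp' h
      rw [hqc] at h
      rw [Ne, collapse_eq_infty_iff, not_not] at hp'
      rw [collapse_eq_infty_iff, not_not] at hp
      obtain ⟨v, rfl⟩ := hp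
      obtain ⟨v', rfl⟩ := hp'
      rw [collapse_apply hj.injective, collapse_apply hj.injective] at h
      rw [OnePoint.coe_injective h]
  obtain ⟨f, ⟨F⟩, hf1, hf2⟩ := both w w'
  have hfinf : ∀ p, q p = OnePoint.infty → f p = mk (x0, y0, 1) := by
    intro p hp
    rcases hinf p hp with ⟨y, t, rfl⟩ | ⟨x, t, rfl⟩
    · exact hf1 y t
    · exact hf2 x t
  have hFinf : ∀ s p, q p = OnePoint.infty → q (F (s, p)) = OnePoint.infty := by
    intro s p hp
    have hP := F.prop s
    rcases hinf p hp with ⟨y, t, rfl⟩ | ⟨x, t, rfl⟩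
    · obtain ⟨y', t', h⟩ := hP.1 y t
      have h' : F (s, mk (x0, y, t)) = mk (x0, y', t') := h
      rw [h', hinf1]
    · obtain ⟨y', t', h⟩ := hP.2 x t
      have h' : F (s, mk (x, y0, t)) = mk (y', y0, t') := h
      rw [h', hinf2]
  obtain ⟨r, hr, hrq⟩ := descend hq hqs f.continuous (by
    intro p p' h
    rcases hfib p p' h with rfl | ⟨h1, h2⟩
    · rfl
    · rw [hfinf p h1, hfinf p' h2])
  obtain ⟨R, hR, hRq⟩ := descend (A := I × CJoin X Y) (B := I × OnePoint (Cell x0 y0))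
    (continuous_id.prodMap hq)
    (Function.surjective_id.prodMap hqs) (hq.comp F.continuous) (by
      rintro ⟨s, p⟩ ⟨s', p'⟩ h
      simp only [Prod.map_apply, id_eq, Prod.mk.injEq] at h
      obtain ⟨rfl, h⟩ := h
      rcases hfib p p' h with rfl | ⟨h1, h2⟩
      · rfl
      · rw [Function.comp_apply, Function.comp_apply, hFinf s p h1, hFinf s p' h2])
  have hRq' : ∀ s p, R (s, q p) = q (F (s, p)) := fun s p => hRq (s, p)
  refine ⟨⟨⟨q, hq⟩, ⟨r, hr⟩, ?_, ?_⟩⟩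
  · have : (ContinuousMap.mk r hr).comp (ContinuousMap.mk q hq) = f := by
      ext p; exact hrq p
    rw [this]
    exact ⟨F.toHomotopy.symm⟩
  · refine ContinuousMap.Homotopic.symm ⟨⟨⟨R, hR⟩, ?_, ?_⟩⟩
    · intro z
      obtain ⟨p, rfl⟩ := hqs z
      change R (0, q p) = q p
      rw [hRq', F.apply_zero]; rfl
    · intro z
      obtain ⟨p, rfl⟩ := hqs z
      change R (1, q p) = q (r (q p))
      rw [hRq', F.apply_one, hrq]

end CJoin

/-! ### Wedges of spheres -/

namespace WS

instance (m : ℕ) : CompactSpace (nSphere m) := by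
  unfold nSphere; infer_instance

instance (m : ℕ) : T2Space (nSphere m) := by
  unfold nSphere nSphere.topologicalSpace; infer_instance

/-- the sphere minus its base point -/
abbrev Punc (m : ℕ) : Type := {x : nSphere m // x ≠ spherePt m}

instance (m : ℕ) : Fact (Module.finrank ℝ (EuclideanSpace ℝ (Fin (m + 1))) = m + 1) :=
  ⟨by simp⟩

theorem punc_homeo (m : ℕ) : Nonempty (Punc m ≃ₜ EuclideanSpace ℝ (Fin m)) := by
  let e := stereographic' (E := EuclideanSpace ℝ (Fin (m + 1))) m (spherePt m)
  have h1 : e.source = {(spherePt m : Metric.sphere (0 : EuclideanSpace ℝ (Fin (m + 1))) 1)}ᶜ :=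
    stereographic'_source _
  have h2 : e.target = univ := stereographic'_target _
  have a : Punc m ≃ₜ e.source := Homeomorph.setCongr (X := nSphere m) (by rw [h1]; rfl)
  exact ⟨a.trans (e.toHomeomorphSourceTarget.trans
    ((Homeomorph.setCongr h2).trans (Homeomorph.Set.univ _)))⟩

variable {ι : Type} (n : ι → ℕ)

/-- disjoint union of the spheres -/
abbrev Tot : Type := Σ i, nSphere (n i)

/-- disjoint union of the punctured spheres -/
abbrev Pun : Type := Σ i, Punc (n i)

/-- inclusion -/
def inc (u : Pun n) : Tot n := ⟨u.1, u.2.1⟩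

theorem isOpenEmbedding_inc : IsOpenEmbedding (inc n) := by
  have h : ∀ i, IsOpenEmbedding (Subtype.val : Punc (n i) → nSphere (n i)) := fun i =>
    (isClosed_singleton.isOpen_compl : IsOpen {x : nSphere (n i) | x ≠ spherePt (n i)}).isOpenEmbedding_subtypeVal
  have hi : Function.Injective (inc n) := by
    rintro ⟨i, x⟩ ⟨j, y⟩ h
    simp only [inc, Sigma.mk.injEq] at h
    obtain ⟨rfl, h⟩ := h
    have := Subtype.ext (eq_of_heq h)
    rw [this]
  refine IsOpenEmbedding.of_continuous_injective_isOpenMap ?_ hi ?_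
  · exact continuous_sigma fun i => continuous_sigmaMk.comp continuous_subtype_val
  · rw [isOpenMap_sigma]
    intro i
    exact isOpenMap_sigmaMk.comp (h i).isOpenMap

/-- quotient map -/
def qm (a : Tot n) : WedgeOfSpheres n := Quot.mk _ a

theorem continuous_qm : Continuous (qm n) := continuous_quot_mk

theorem qm_surj : Function.Surjective (qm n) := Quot.mk_surjective

variable {n}

/-- base points -/
def IsBase (a : Tot n) : Prop := a.2 = spherePt (n a.1)

theorem isBase_mk (i : ι) : IsBase (⟨i, spherePt (n i)⟩ : Tot n) := rfl

theorem isBase_iff {a : Tot n} : IsBase a ↔ ¬ ∃ u, inc n u = a := by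
  constructor
  · rintro h ⟨u, rfl⟩
    exact u.2.2 h
  · intro h
    by_contra hb
    exact h ⟨⟨a.1, a.2, hb⟩, rfl⟩

theorem qm_base {a b : Tot n} (ha : IsBase a) (hb : IsBase b) : qm n a = qm n b := by
  obtain ⟨i, x⟩ := a
  obtain ⟨j, y⟩ := b
  exact Quot.sound ⟨i, j, congrArg (Sigma.mk i) ha, congrArg (Sigma.mk j) hb⟩

variable (n)

/-- the comparison with the one point compactification -/
def toOne (w : WedgeOfSpheres n) : OnePoint (Pun n) :=
  Quot.lift (collapse (inc n)) (by
    rintro _ _ ⟨i, j, rfl, rfl⟩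
    rw [collapse_infty (isBase_iff.1 (isBase_mk i)), collapse_infty (isBase_iff.1 (isBase_mk j))]) w

theorem toOne_qm (a : Tot n) : toOne n (qm n a) = collapse (inc n) a := rfl

theorem continuous_toOne : Continuous (toOne n) :=
  continuous_quot_lift _ (continuous_collapse (isOpenEmbedding_inc n))

theorem toOne_inj : Function.Injective (toOne n) := by
  intro p q
  obtain ⟨a, rfl⟩ := qm_surj n p
  obtain ⟨b, rfl⟩ := qm_surj n q
  rw [toOne_qm, toOne_qm]
  intro h
  by_cases ha : IsBase a
  · have hb : IsBase b := by
      rw [isBase_iff, ← collapse_eq_infty_iff, ← h, collapse_eq_infty_iff, ← isBase_iff]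
      exact ha
    exact qm_base ha hb
  · rw [isBase_iff, not_not] at ha
    obtain ⟨u, rfl⟩ := ha
    by_cases hb : IsBase b
    · rw [collapse_infty (isBase_iff.1 hb), collapse_eq_infty_iff] at h
      exact absurd ⟨u, rfl⟩ h
    · rw [isBase_iff, not_not] at hb
      obtain ⟨v, rfl⟩ := hb
      have hj := (isOpenEmbedding_inc n).injective
      rw [collapse_apply hj, collapse_apply hj] at h
      rw [OnePoint.coe_injective h]

theorem toOne_surj (i0 : ι) : Function.Surjective (toOne n) := by
  intro z
  induction z using OnePoint.rec with
  | infty => exact ⟨qm n ⟨i0, spherePt _⟩, collapse_infty (isBase_iff.1 rfl)⟩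
  | coe u => exact ⟨qm n (inc n u), collapse_apply (isOpenEmbedding_inc n).injective u⟩

instance (m : ℕ) : LocallyCompactSpace (Punc m) :=
  (isClosed_singleton.isOpen_compl : IsOpen {x : nSphere m | x ≠ spherePt m}).locallyCompactSpace

instance [Finite ι] : LocallyCompactSpace (Pun n) := by
  have : CompactSpace (Tot n) := inferInstance
  exact (isOpenEmbedding_inc n).locallyCompactSpace

instance [Finite ι] : CompactSpace (WedgeOfSpheres n) :=
  Quot.compactSpace

/-- the wedge as a one point compactification -/
def oneHomeo [Finite ι] (i0 : ι) : WedgeOfSpheres n ≃ₜ OnePoint (Pun n) :=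
  (continuous_toOne n).homeoOfEquivCompactToT2
    (f := Equiv.ofBijective (toOne n) ⟨toOne_inj n, toOne_surj n i0⟩)

instance [Finite ι] : T2Space (WedgeOfSpheres n) :=
  T2Space.of_injective_continuous (toOne_inj n) (continuous_toOne n)

/-- base point of the wedge -/
def bp (i0 : ι) : WedgeOfSpheres n := qm n ⟨i0, spherePt _⟩

theorem qm_eq_bp {i0 : ι} {a : Tot n} : qm n a = bp n i0 ↔ IsBase a := by
  constructor
  · intro h
    have := congrArg (toOne n) h
    rw [bp, toOne_qm, toOne_qm, collapse_infty (isBase_iff.1 (isBase_mk i0)),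
      collapse_eq_infty_iff] at this
    exact isBase_iff.2 this
  · intro h
    exact qm_base h rfl

theorem qm_eq_iff {a b : Tot n} : qm n a = qm n b → a = b ∨ (IsBase a ∧ IsBase b) := by
  intro h
  by_cases ha : IsBase a
  · refine Or.inr ⟨ha, ?_⟩
    rw [← qm_eq_bp n (i0 := a.1), ← h, qm_eq_bp]
    exact ha
  · by_cases hb : IsBase b
    · refine absurd ?_ ha
      rw [← qm_eq_bp n (i0 := b.1), h, qm_eq_bp]
      exact hb
    · rw [isBase_iff, not_not] at ha hb
      obtain ⟨u, rfl⟩ := ha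
      obtain ⟨v, rfl⟩ := hb
      have hj := (isOpenEmbedding_inc n).injective
      have h' := congrArg (toOne n) h
      rw [toOne_qm, toOne_qm, collapse_apply hj, collapse_apply hj] at h'
      rw [OnePoint.coe_injective h']
      exact Or.inl rfl

theorem minus_bp [Finite ι] (i0 : ι) : Nonempty ({x // x ≠ bp n i0} ≃ₜ Pun n) := by
  let e := oneHomeo n i0
  have he : e (bp n i0) = OnePoint.infty := collapse_infty (isBase_iff.1 rfl)
  have a : {x // x ≠ bp n i0} ≃ₜ {z : OnePoint (Pun n) // z ∈ range (OnePoint.some : Pun n → _)} :=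
    e.subtype (fun x => by
      rw [← OnePoint.compl_infty, mem_compl_iff, mem_singleton_iff, ← he, e.injective.eq_iff])
  exact ⟨a.trans OnePoint.isOpenEmbedding_coe.isEmbedding.toHomeomorph.symm⟩

/-! well-pointedness -/

/-- sphere height -/
def ht {m : ℕ} (x : nSphere m) : ℝ := x.1 0

theorem continuous_val {m : ℕ} :
    Continuous (fun x : nSphere m => (x.1 : EuclideanSpace ℝ (Fin (m + 1)))) :=
  continuous_subtype_val

theorem continuous_ht {m : ℕ} : Continuous (ht : nSphere m → ℝ) := by
  have := continuous_val (m := m)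
  unfold ht
  fun_prop

/-- parameter -/
def pa {m : ℕ} (p : nSphere m × I) : ℝ := min 1 (p.2 * (1 + ht p.1))

theorem continuous_pa {m : ℕ} : Continuous (pa : nSphere m × I → ℝ) := by
  have := continuous_ht (m := m)
  unfold pa
  fun_prop

/-- unnormalized push -/
def push {m : ℕ} (p : nSphere m × I) : EuclideanSpace ℝ (Fin (m + 1)) :=
  (1 - pa p) • p.1.1 + pa p • (spherePt m).1

theorem norm_val {m : ℕ} (x : nSphere m) : ‖x.1‖ = 1 := by
  have := x.2
  rwa [mem_sphere_zero_iff_norm] at this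

theorem push_ne {m : ℕ} (p : nSphere m × I) : push p ≠ 0 := by
  intro h
  unfold push at h
  have h1 := eq_neg_of_add_eq_zero_left h
  have h2 := congrArg norm h1
  rw [norm_neg, norm_smul, norm_smul, norm_val, norm_val, mul_one, mul_one,
    Real.norm_eq_abs, Real.norm_eq_abs] at h2
  have h3 : pa p = 1 / 2 := by
    rcases abs_eq_abs.1 h2 with h | h <;> linarith
  have h4 := congrArg (fun v : EuclideanSpace ℝ (Fin (m + 1)) => v 0) h1
  have h5 : ((spherePt m).1 : EuclideanSpace ℝ (Fin (m + 1))) 0 = 1 := by simp [spherePt]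
  simp only [PiLp.smul_apply, PiLp.neg_apply, smul_eq_mul, h5, h3] at h4
  have h6 : ht p.1 = -1 := by
    have : ht p.1 = p.1.1 0 := rfl
    linarith
  have h7 : pa p = 0 := by simp [pa, h6]
  rw [h7] at h3
  norm_num at h3

/-- push -/
def psh {m : ℕ} (p : nSphere m × I) : nSphere m :=
  ⟨‖push p‖⁻¹ • push p, by
    rw [mem_sphere_zero_iff_norm, norm_smul, norm_inv, norm_norm,
      inv_mul_cancel₀ (norm_ne_zero_iff.2 (push_ne p))]⟩

theorem continuous_psh {m : ℕ} : Continuous (psh : nSphere m × I → nSphere m) := by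
  have h1 := continuous_pa (m := m)
  have h2 : Continuous (fun p : nSphere m × I => (p.1.1 : EuclideanSpace ℝ (Fin (m + 1)))) :=
    continuous_val.comp continuous_fst
  have h : Continuous (push : nSphere m × I → _) := by
    unfold push
    exact ((continuous_const.sub h1).smul h2).add (h1.smul continuous_const)
  exact Continuous.subtype_mk ((h.norm.inv₀ fun p => norm_ne_zero_iff.2 (push_ne p)).smul h) _

theorem psh_eq {m : ℕ} (p : nSphere m × I) (x : nSphere m) (h : push p = x.1) : psh p = x := by
  apply Subtype.ext
  change ‖push p‖⁻¹ • push p = x.1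
  rw [h, norm_val]
  simp

theorem psh_zero {m : ℕ} (x : nSphere m) : psh (x, 0) = x :=
  psh_eq _ _ (by simp [push, pa])

theorem psh_base {m : ℕ} (s : I) : psh (spherePt m, s) = spherePt m :=
  psh_eq _ _ (by simp only [push]; rw [← add_smul]; simp)

theorem psh_one {m : ℕ} (x : nSphere m) (h : 0 < ht x) : psh (x, 1) = spherePt m :=
  psh_eq _ _ (by
    have : pa (x, 1) = 1 := by simp [pa, h.le]
    simp [push, this])

theorem wellPt [Finite ι] (i0 : ι) : Nonempty (WellPt (WedgeOfSpheres n) (bp n i0)) := by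
  let φ : Tot n × I → WedgeOfSpheres n := fun p => qm n ⟨p.1.1, psh (p.1.2, p.2)⟩
  have hφ : Continuous φ := by
    have : Continuous (φ ∘ (Homeomorph.sigmaProdDistrib (X := fun i => nSphere (n i)) (Y := I)).symm) := by
      refine continuous_sigma fun i => ?_
      exact (continuous_qm n).comp (continuous_sigmaMk.comp continuous_psh)
    simpa [Function.comp_assoc] using
      this.comp (Homeomorph.sigmaProdDistrib (X := fun i => nSphere (n i)) (Y := I)).continuous
  have hb : ∀ (a : Tot n) (s : I), IsBase a → φ (a, s) = bp n i0 := by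
    rintro ⟨i, x⟩ s h
    change x = spherePt (n i) at h
    subst h
    rw [qm_eq_bp]
    exact psh_base s
  obtain ⟨D, hD, hD'⟩ := descend (q := Prod.map (qm n) (id : I → I))
    ((continuous_qm n).prodMap continuous_id) ((qm_surj n).prodMap Function.surjective_id) hφ (by
      rintro ⟨a, s⟩ ⟨b, t⟩ h
      simp only [Prod.map_apply, id, Prod.mk.injEq] at h
      obtain ⟨h, rfl⟩ := h
      rcases qm_eq_iff n h with rfl | ⟨h1, h2⟩
      · rfl
      · rw [hb _ _ h1, hb _ _ h2])
  let l : Tot n → ℝ := fun a => max 0 (ht a.2)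
  have hlc : Continuous l := continuous_sigma fun i => by
    have := continuous_ht (m := n i)
    exact continuous_const.max this
  have hlb : ∀ a, IsBase a → l a = 1 := by
    rintro ⟨i, x⟩ h
    change x = spherePt (n i) at h
    subst h
    simp [l, ht, spherePt]
  obtain ⟨lam, hl, hl'⟩ := descend (continuous_qm n) (qm_surj n) hlc (by
      intro a b h
      rcases qm_eq_iff n h with rfl | ⟨h1, h2⟩
      · rfl
      · rw [hlb _ h1, hlb _ h2])
  refine ⟨⟨D, hD, ?_, ?_, lam, hl, ?_, ?_⟩⟩
  · intro x
    obtain ⟨a, rfl⟩ := qm_surj n x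
    refine (hD' (a, 0)).trans ?_
    simp only [φ, psh_zero]
  · intro s
    exact (hD' (⟨i0, spherePt _⟩, s)).trans (hb _ _ (isBase_mk i0))
  · exact (hl' _).trans (hlb _ (isBase_mk i0))
  · intro x hx
    obtain ⟨⟨i, a⟩, rfl⟩ := qm_surj n x
    rw [hl'] at hx
    have : 0 < ht a := by
      by_contra h
      exact hx (max_eq_left (not_lt.1 h))
    refine (hD' (⟨i, a⟩, 1)).trans ?_
    rw [qm_eq_bp]
    exact psh_one a this

/-! the cells of the join -/

theorem interval_homeo : Nonempty ({t : I // t ≠ 0 ∧ t ≠ 1} ≃ₜ ℝ) := by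
  have a : {t : I // t ≠ 0 ∧ t ≠ 1} ≃ₜ Ioo (-1 : ℝ) 1 :=
    { toFun := fun t => ⟨2 * t.1.1 - 1, by
          have := lt_of_le_of_ne t.1.2.1 (fun h => t.2.1 (Subtype.ext h.symm))
          linarith, by
          have := lt_of_le_of_ne t.1.2.2 (fun h => t.2.2 (Subtype.ext h))
          linarith⟩
      invFun := fun t => ⟨⟨(t.1 + 1) / 2, by linarith [t.2.1], by linarith [t.2.2]⟩,
        fun h => by
          have h1 : (t.1 + 1) / 2 = 0 := congrArg Subtype.val h
          linarith [t.2.1],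
        fun h => by
          have h1 : (t.1 + 1) / 2 = 1 := congrArg Subtype.val h
          linarith [t.2.2]⟩
      left_inv := fun t => by
        apply Subtype.ext
        apply Subtype.ext
        change (2 * t.1.1 - 1 + 1) / 2 = t.1.1
        ring
      right_inv := fun t => by
        apply Subtype.ext
        change 2 * ((t.1 + 1) / 2) - 1 = t.1
        ring
      continuous_toFun := by fun_prop
      continuous_invFun := by fun_prop }
  exact ⟨a.trans (orderIsoIooNegOneOne ℝ).toHomeomorph.symm⟩

theorem cell_homeo (a b : ℕ) : Nonempty (Punc a × Punc b × ℝ ≃ₜ Punc (a + b + 1)) := by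
  obtain ⟨e1⟩ := punc_homeo a
  obtain ⟨e2⟩ := punc_homeo b
  obtain ⟨e3⟩ := punc_homeo (a + b + 1)
  obtain ⟨f⟩ : Nonempty ((EuclideanSpace ℝ (Fin a) × EuclideanSpace ℝ (Fin b) × ℝ) ≃L[ℝ]
      EuclideanSpace ℝ (Fin (a + b + 1))) := by
    refine FiniteDimensional.nonempty_continuousLinearEquiv_of_finrank_eq ?_
    simp [add_assoc]
  exact ⟨((e1.prodCongr (e2.prodCongr (Homeomorph.refl ℝ))).trans f.toHomeomorph).trans e3.symm⟩

theorem sigma_congr {κ : Type} {A B : κ → Type} [∀ k, TopologicalSpace (A k)]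
    [∀ k, TopologicalSpace (B k)] (e : ∀ k, A k ≃ₜ B k) : Nonempty ((Σ k, A k) ≃ₜ Σ k, B k) :=
  ⟨{ toEquiv := Equiv.sigmaCongrRight fun k => (e k).toEquiv
     continuous_toFun := continuous_sigma fun k => continuous_sigmaMk.comp (e k).continuous
     continuous_invFun := continuous_sigma fun k => continuous_sigmaMk.comp (e k).symm.continuous }⟩

theorem prod_sigma {κ κ' Z : Type} {A : κ → Type} {B : κ' → Type} [∀ k, TopologicalSpace (A k)]
    [∀ k, TopologicalSpace (B k)] [TopologicalSpace Z] :
    Nonempty (((Σ k, A k) × (Σ k, B k) × Z) ≃ₜ Σ p : κ × κ', A p.1 × B p.2 × Z) := by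
  refine ⟨{ toFun := fun x => ⟨(x.1.1, x.2.1.1), x.1.2, x.2.1.2, x.2.2⟩
            invFun := fun y => (⟨y.1.1, y.2.1⟩, ⟨y.1.2, y.2.2.1⟩, y.2.2.2)
            left_inv := fun _ => rfl
            right_inv := fun _ => rfl
            continuous_toFun := ?_
            continuous_invFun := ?_ }⟩
  · rw [continuous_iff_continuousAt]
    rintro ⟨⟨k, a⟩, ⟨k', b⟩, z⟩
    have h : IsOpenEmbedding (Prod.map (Sigma.mk k) (Prod.map (Sigma.mk k') id) :
        A k × B k' × Z → (Σ k, A k) × (Σ k, B k) × Z) :=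
      IsOpenEmbedding.sigmaMk.prodMap (IsOpenEmbedding.sigmaMk.prodMap .id)
    refine (h.continuousAt_iff (x := (a, b, z))).1 ?_
    exact (@continuous_sigmaMk _ (fun p : κ × κ' => A p.1 × B p.2 × Z) _ (k, k')).continuousAt
  · refine continuous_sigma fun p => ?_
    exact (continuous_sigmaMk.comp continuous_fst).prodMk
      ((continuous_sigmaMk.comp (continuous_fst.comp continuous_snd)).prodMk
        (continuous_snd.comp continuous_snd))

theorem join_wedge {κ κ' : Type} [Finite κ] [Finite κ'] (n : κ → ℕ) (m : κ' → ℕ) (i0 : κ)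
    (j0 : κ') : Nonempty (ContinuousMap.HomotopyEquiv (CJoin (WedgeOfSpheres n) (WedgeOfSpheres m))
      (WedgeOfSpheres (fun p : κ × κ' => n p.1 + m p.2 + 1))) := by
  obtain ⟨w⟩ := wellPt n i0
  obtain ⟨w'⟩ := wellPt m j0
  obtain ⟨e⟩ := CJoin.collapse_hequiv w w'
  obtain ⟨a1⟩ := minus_bp n i0
  obtain ⟨a2⟩ := minus_bp m j0
  obtain ⟨a3⟩ := interval_homeo
  obtain ⟨b⟩ := prod_sigma (A := fun i => Punc (n i)) (B := fun i => Punc (m i)) (Z := ℝ)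
  obtain ⟨c⟩ := sigma_congr (fun p : κ × κ' => (cell_homeo (n p.1) (m p.2)).some)
  let f : CJoin.Cell (bp n i0) (bp m j0) ≃ₜ Pun (fun p : κ × κ' => n p.1 + m p.2 + 1) :=
    ((a1.prodCongr (a2.prodCongr a3)).trans b).trans c
  exact ⟨e.trans ((f.onePointCongr.trans (oneHomeo _ (i0, j0)).symm).toHomotopyEquiv)⟩

theorem reindex {κ κ' : Type} [Finite κ] [Finite κ'] (e : κ ≃ κ') (i0 : κ) (n : κ' → ℕ) :
    Nonempty (WedgeOfSpheres (fun k => n (e k)) ≃ₜ WedgeOfSpheres n) := by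
  let g : Pun (fun k => n (e k)) ≃ Pun n := Equiv.sigmaCongrLeft (β := fun k => Punc (n k)) e
  have h1 : Continuous g := continuous_sigma fun k =>
    @continuous_sigmaMk _ (fun k => Punc (n k)) _ (e k)
  have h2 : IsOpenMap g := isOpenMap_sigma.2 fun k =>
    @isOpenMap_sigmaMk _ (fun k => Punc (n k)) _ (e k)
  let f := g.toHomeomorphOfContinuousOpen h1 h2
  exact ⟨(oneHomeo _ i0).trans (f.onePointCongr.trans (oneHomeo n (e i0)).symm)⟩

theorem isWedge {k l : ℕ} (n : Fin k → ℕ) (m : Fin l → ℕ) (hk : k ≠ 0) (hl : l ≠ 0) :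
    IsWedgeOfSpheres (CJoin (WedgeOfSpheres n) (WedgeOfSpheres m)) := by
  let i0 : Fin k := ⟨0, Nat.pos_of_ne_zero hk⟩
  let j0 : Fin l := ⟨0, Nat.pos_of_ne_zero hl⟩
  obtain ⟨e⟩ := join_wedge n m i0 j0
  let r : Fin (k * l) ≃ Fin k × Fin l := finProdFinEquiv.symm
  obtain ⟨f⟩ := reindex r (r.symm (i0, j0)) (fun p : Fin k × Fin l => n p.1 + m p.2 + 1)
  exact ⟨k * l, _, ⟨e.trans f.symm.toHomotopyEquiv⟩⟩

instance {κ : Type} [IsEmpty κ] (n : κ → ℕ) : IsEmpty (WedgeOfSpheres n) :=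
  ⟨fun w => by
    obtain ⟨a, -⟩ := qm_surj n w
    exact isEmptyElim a.1⟩

end WS

theorem IsWedgeOfSpheres.congr {X Y : Type*} [TopologicalSpace X] [TopologicalSpace Y]
    (e : ContinuousMap.HomotopyEquiv X Y) (h : IsWedgeOfSpheres Y) : IsWedgeOfSpheres X := by
  obtain ⟨k, n, ⟨f⟩⟩ := h
  exact ⟨k, n, ⟨e.trans f⟩⟩

theorem isWedgeOfSpheres_of_isEmpty (X : Type*) [TopologicalSpace X] [IsEmpty X] :
    IsWedgeOfSpheres X := by
  have e : X ≃ₜ WedgeOfSpheres (fun _ : Fin 0 => 0) :=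
    { toEquiv := Equiv.equivOfIsEmpty _ _
      continuous_toFun := continuous_of_const fun x => isEmptyElim x
      continuous_invFun := continuous_of_const fun x => isEmptyElim x }
  exact ⟨0, _, ⟨e.toHomotopyEquiv⟩⟩

theorem CJoin.wedge {X Y : Type*} [TopologicalSpace X] [TopologicalSpace Y]
    (h1 : ContractibleSpace X ∨ IsWedgeOfSpheres X)
    (h2 : ContractibleSpace Y ∨ IsWedgeOfSpheres Y) :
    ContractibleSpace (CJoin X Y) ∨ IsWedgeOfSpheres (CJoin X Y) := by
  rcases h1 with h1 | h1
  · exact Or.inl CJoin.contractible_left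
  rcases h2 with h2 | h2
  · exact Or.inl CJoin.contractible_right
  right
  have h1' := h1
  have h2' := h2
  obtain ⟨k, n, ⟨e⟩⟩ := h1
  obtain ⟨l, m, ⟨f⟩⟩ := h2
  by_cases hk : k = 0
  · subst hk
    have : IsEmpty X := ⟨fun x => isEmptyElim (e.toFun x)⟩
    obtain ⟨g⟩ := CJoin.homeo_of_isEmpty (X := X) (Y := Y)
    exact h2'.congr g.toHomotopyEquiv
  by_cases hl : l = 0
  · subst hl
    have : IsEmpty Y := ⟨fun x => isEmptyElim (f.toFun x)⟩
    obtain ⟨g⟩ := CJoin.homeo_of_isEmpty (X := Y) (Y := X)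
    exact h1'.congr (CJoin.swapHomeo.trans g).toHomotopyEquiv
  exact (WS.isWedge n m hk hl).congr (CJoin.hequiv e f)

theorem realization_isEmpty {α : Type*} {K : Set (Finset α)} (h : K = ∅) :
    IsEmpty (realization K) :=
  ⟨fun f => by
    obtain ⟨s, hs, -⟩ := f.2.2
    rw [h] at hs
    exact hs⟩

/-- If each of two simplicial complexes is contractible or homotopy equivalent to a wedge of
spheres, then so is their join. -/
theorem join_contractible_or_wedge_of_spheres
    {α β : Type*} [DecidableEq α] [DecidableEq β] (K : Set (Finset α)) (L : Set (Finset β))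
    (hK : ∀ s ∈ K, ∀ t ⊆ s, t ∈ K) (hL : ∀ s ∈ L, ∀ t ⊆ s, t ∈ L)
    (h1 : ContractibleSpace (realization K) ∨ IsWedgeOfSpheres (realization K))
    (h2 : ContractibleSpace (realization L) ∨ IsWedgeOfSpheres (realization L)) :
    ContractibleSpace (realization (joinComplex K L)) ∨
      IsWedgeOfSpheres (realization (joinComplex K L)) := by
  rcases K.eq_empty_or_nonempty with rfl | ⟨s, hs⟩
  · have := realization_isEmpty (K := joinComplex (∅ : Set (Finset α)) L)
      (by ext u; simp [joinComplex])
    exact Or.inr (isWedgeOfSpheres_of_isEmpty _)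
  rcases L.eq_empty_or_nonempty with rfl | ⟨t, ht⟩
  · have := realization_isEmpty (K := joinComplex K (∅ : Set (Finset β)))
      (by ext u; simp [joinComplex])
    exact Or.inr (isWedgeOfSpheres_of_isEmpty _)
  have e := RealJoin.homeo (hK s hs ∅ (Finset.empty_subset _)) (hL t ht ∅ (Finset.empty_subset _))
  rcases CJoin.wedge h1 h2 with h | h
  · exact Or.inl e.contractibleSpace
  · exact Or.inr (h.congr e.toHomotopyEquiv)
end
end

section
/- The weak dual of a biconnected outerplanar graph is a tree, and more generally the weak dual of any outerplanar graph is a forest. -/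
noncomputable section

namespace WD
open SimpleGraph

variable {V : Type*}

/-- Order-theoretic data of a face with vertex set `S`. -/
structure IsF (G : SimpleGraph V) (f : V → ℝ) (S : Set V) : Prop where
  inj : Function.Injective f
  ne : S.Nonempty
  lam : ∀ u v, G.Adj u v → f u < f v →
    (∀ x ∈ S, ¬ (f u < f x ∧ f x < f v)) ∨ (∀ x ∈ S, f u ≤ f x ∧ f x ≤ f v)
  two : ∀ v ∈ S, ∃ x ∈ S, ∃ y ∈ S, f x < f y ∧ G.Adj v x ∧ G.Adj v y

variable {G : SimpleGraph V} {f : V → ℝ} {S T : Set V}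

theorem IsF.fne (hS : IsF G f S) {x y : V} (h : G.Adj x y) : f x ≠ f y :=
  fun e => h.ne (hS.inj e)

theorem IsF.top [Finite V] (hS : IsF G f S) :
    ∃ m ∈ S, ∃ M ∈ S, G.Adj m M ∧ f m < f M ∧ ∀ x ∈ S, f m ≤ f x ∧ f x ≤ f M := by
  obtain ⟨m, hm, hmin⟩ := Set.exists_min_image S f S.toFinite hS.ne
  obtain ⟨x, hx, y, hy, hxy, hax, hay⟩ := hS.two m hm
  have h1 := lt_of_le_of_ne (hmin x hx) (hS.fne hax)
  have hmy : f m < f y := h1.trans hxy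
  rcases hS.lam m y hay hmy with h | h
  · exact absurd ⟨h1, hxy⟩ (h x hx)
  · exact ⟨m, hm, y, hy, hay, hmy, h⟩

theorem IsF.gap (hS : IsF G f S) {u : V} (hu : u ∈ S) {w : V} (hw : w ∈ S) (huw : f u < f w) :
    ∃ y ∈ S, G.Adj u y ∧ f u < f y ∧ (∀ z ∈ S, ¬ (f u < f z ∧ f z < f y)) ∧
      ∃ z ∈ S, ¬ (f u ≤ f z ∧ f z ≤ f y) := by
  obtain ⟨x, hx, y, hy, hxy, hax, hay⟩ := hS.two u hu
  have hnx := hS.fne hax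
  have hny := hS.fne hay
  by_cases hmin : ∃ z ∈ S, f z < f u
  · obtain ⟨z, hz, hzu⟩ := hmin
    have huy : f u < f y := by
      by_contra hc
      have hyu : f y < f u := lt_of_le_of_ne (not_lt.mp hc) (Ne.symm hny)
      rcases hS.lam x u hax.symm (hxy.trans hyu) with h | h
      · exact h y hy ⟨hxy, hyu⟩
      · linarith [(h w hw).2]
    refine ⟨y, hy, hay, huy, ?_, z, hz, fun h => by linarith [h.1]⟩
    rcases hS.lam u y hay huy with h | h
    · exact h
    · linarith [(h z hz).1]
  · push Not at hmin
    have hux : f u < f x := lt_of_le_of_ne (hmin x hx) hnx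
    refine ⟨x, hx, hax, hux, ?_, y, hy, fun h => by linarith [h.2]⟩
    rcases hS.lam u x hax hux with h | h
    · exact h
    · linarith [(h y hy).2]

/-- A non-vertex lying between two vertices of a face is below a lower edge of that face. -/
theorem IsF.gap' [Finite V] (hS : IsF G f S) {x p q : V} (hx : x ∉ S) (hp : p ∈ S) (hq : q ∈ S)
    (hpx : f p < f x) (hxq : f x < f q) :
    ∃ u ∈ S, ∃ y ∈ S, G.Adj u y ∧ f u < f x ∧ f x < f y ∧
      (∀ z ∈ S, ¬ (f u < f z ∧ f z < f y)) ∧ ∃ z ∈ S, ¬ (f u ≤ f z ∧ f z ≤ f y) := by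
  obtain ⟨u, ⟨hu, hux⟩, hmax⟩ := Set.exists_max_image {z | z ∈ S ∧ f z < f x} f
    (Set.toFinite _) ⟨p, hp, hpx⟩
  obtain ⟨y, hy, hadj, huy, h1, h2⟩ := hS.gap hu hq (hux.trans hxq)
  refine ⟨u, hu, y, hy, hadj, hux, ?_, h1, h2⟩
  by_contra hc
  have hne : f y ≠ f x := fun h => hx (hS.inj h ▸ hy)
  have := hmax y ⟨hy, lt_of_le_of_ne (not_lt.mp hc) hne⟩
  linarith

theorem IsF.third (hS : IsF G f S) {a b : V} (h1 : ∀ x ∈ S, ¬ (f a < f x ∧ f x < f b))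
    (h2 : ∀ x ∈ S, f a ≤ f x ∧ f x ≤ f b) (hab : f a < f b) : False := by
  obtain ⟨v, hv⟩ := hS.ne
  obtain ⟨x, hx, y, hy, hxy, hax, hay⟩ := hS.two v hv
  have hnx := hS.fne hax
  have hny := hS.fne hay
  have key : ∀ z ∈ S, f z = f a ∨ f z = f b := fun z hz => by
    by_contra hc
    push Not at hc
    exact h1 z hz ⟨lt_of_le_of_ne (h2 z hz).1 (Ne.symm hc.1), lt_of_le_of_ne (h2 z hz).2 hc.2⟩
  rcases key v hv with h | h <;> rcases key x hx with h' | h' <;> rcases key y hy with h'' | h'' <;>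
    first
    | exact hnx (h.trans h'.symm)
    | exact hny (h.trans h''.symm)
    | linarith

theorem top_sub [Finite V] (hS : IsF G f S) (hT : IsF G f T) {a b : V} (haS : a ∈ S) (hbS : b ∈ S)
    (haT : a ∈ T) (hbT : b ∈ T) (tS : ∀ x ∈ S, f a ≤ f x ∧ f x ≤ f b)
    (tT : ∀ x ∈ T, f a ≤ f x ∧ f x ≤ f b) : T ⊆ S := by
  intro x hx
  by_contra hxS
  have h1 : f a ≠ f x := fun h => hxS (hS.inj h ▸ haS)
  have h2 : f x ≠ f b := fun h => hxS (hS.inj h ▸ hbS)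
  obtain ⟨u, hu, y, hy, hadj, hux, hxy, -, z, hz, hzo⟩ := hS.gap' hxS haS hbS
    (lt_of_le_of_ne (tT x hx).1 h1) (lt_of_le_of_ne (tT x hx).2 h2)
  rcases hT.lam u y hadj (hux.trans hxy) with h | h
  · exact h x hx ⟨hux, hxy⟩
  · exact hzo ⟨(h a haT).1.trans (tS z hz).1, (tS z hz).2.trans (h b hbT).2⟩

theorem bot_sub [Finite V] (hS : IsF G f S) (hT : IsF G f T) {a b : V} (hab : f a < f b)
    (haS : a ∈ S) (hbS : b ∈ S)
    (haT : a ∈ T) (hbT : b ∈ T) (tS : ∀ x ∈ S, ¬ (f a < f x ∧ f x < f b))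
    (tT : ∀ x ∈ T, ¬ (f a < f x ∧ f x < f b)) : T ⊆ S := by
  intro x hx
  by_contra hxS
  obtain ⟨m, hm, M, hM, hadj, hmM, htop⟩ := hS.top
  have hin : f m ≤ f x ∧ f x ≤ f M := by
    rcases hT.lam m M hadj hmM with h | h
    · exfalso
      have ha := htop a haS
      have hb := htop b hbS
      have ha' : f a = f m := by
        by_contra hc
        exact h a haT ⟨lt_of_le_of_ne ha.1 (Ne.symm hc), by linarith⟩
      have hb' : f b = f M := by
        by_contra hc
        exact h b hbT ⟨by linarith, lt_of_le_of_ne hb.2 hc⟩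
      exact hS.third tS (fun z hz => by rw [ha', hb']; exact htop z hz) hab
    · exact h x hx
  have h1 : f m ≠ f x := fun h => hxS (hS.inj h ▸ hm)
  have h2 : f x ≠ f M := fun h => hxS (hS.inj h ▸ hM)
  obtain ⟨u, hu, y, hy, hadj, hux, hxy, hg, -⟩ := hS.gap' hxS hm hM
    (lt_of_le_of_ne hin.1 h1) (lt_of_le_of_ne hin.2 h2)
  rcases hT.lam u y hadj (hux.trans hxy) with h | h
  · exact h x hx ⟨hux, hxy⟩
  · have ha := h a haT
    have hb := h b hbT
    have ha' : f a = f u := by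
      by_contra hc
      exact hg a haS ⟨lt_of_le_of_ne ha.1 (Ne.symm hc), by linarith⟩
    have hb' : f b = f y := by
      by_contra hc
      exact hg b hbS ⟨by linarith, lt_of_le_of_ne hb.2 hc⟩
    exact tT x hx ⟨by linarith, by linarith⟩

/-! ### Cycles give faces -/

theorem exists_mem_of_walk (nc : ∀ a b c d, G.Adj a b → G.Adj c d → f a < f c → f c < f b →
    f b < f d → False) (hinj : Function.Injective f) {u v : V} (huv : G.Adj u v)
    {x y : V} (q : G.Walk x y) (hx : f u < f x ∧ f x < f v) (hy : ¬ (f u ≤ f y ∧ f y ≤ f v)) :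
    u ∈ q.support ∨ v ∈ q.support := by
  induction q with
  | nil => exact absurd ⟨hx.1.le, hx.2.le⟩ hy
  | @cons x z y h q ih =>
    by_cases hzu : z = u
    · left; simp [← hzu]
    by_cases hzv : z = v
    · right; simp [← hzv]
    have h1 : f z ≠ f u := fun e => hzu (hinj e)
    have h2 : f z ≠ f v := fun e => hzv (hinj e)
    have hz : f u < f z ∧ f z < f v := by
      constructor
      · by_contra hc
        exact nc z x u v h.symm huv (lt_of_le_of_ne (not_lt.mp hc) h1) hx.1 hx.2
      · by_contra hc
        exact nc u v x z huv h hx.1 hx.2 (lt_of_le_of_ne (not_lt.mp hc) (Ne.symm h2))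
    rcases ih hz hy with h | h
    · left; simp [h]
    · right; simp [h]

theorem cycle_isF (nc : ∀ a b c d, G.Adj a b → G.Adj c d → f a < f c → f c < f b →
    f b < f d → False) (hinj : Function.Injective f) {w : V} (p : G.Walk w w) (hp : p.IsCycle)
    (hch : Chordless G p) : IsF G f {x | x ∈ p.support} := by
  classical
  refine ⟨hinj, ⟨w, p.start_mem_support⟩, ?_, ?_⟩
  · intro u v huv hlt
    by_contra hcon
    push Not at hcon
    obtain ⟨⟨x, hx, hxi⟩, y, hy, hyo⟩ := hcon
    have hyo' : ¬ (f u ≤ f y ∧ f y ≤ f v) := fun h => absurd h.2 (not_le.mpr (hyo h.1))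
    have hx : x ∈ p.support := hx
    have hy : y ∈ p.support := hy
    have hy' : y ∈ (p.rotate x hx).support := by simpa using hy
    have hc := hp.rotate hx
    set c := p.rotate x hx with hcdef
    set q := c.takeUntil y hy' with hq
    set r := c.dropUntil y hy' with hr
    have hspec : q.append r = c := c.take_spec hy'
    have hnd := hc.support_nodup
    rw [← hspec, Walk.tail_support_append, List.nodup_append'] at hnd
    have hdis : ∀ z, z ≠ x → z ≠ y → z ∈ q.support → z ∈ r.support → False := by
      intro z hzx hzy hz1 hz2
      rw [Walk.mem_support_iff] at hz1 hz2
      exact hnd.2.2 (hz1.resolve_left hzx) (hz2.resolve_left hzy)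
    have hux : u ≠ x := by rintro rfl; exact lt_irrefl _ hxi.1
    have hvx : v ≠ x := by rintro rfl; exact lt_irrefl _ hxi.2
    have huy : u ≠ y := by rintro rfl; exact hyo' ⟨le_rfl, hlt.le⟩
    have hvy : v ≠ y := by rintro rfl; exact hyo' ⟨hlt.le, le_rfl⟩
    have hA := exists_mem_of_walk nc hinj huv q hxi hyo'
    have hB := exists_mem_of_walk nc hinj huv r.reverse hxi hyo'
    simp only [Walk.support_reverse, List.mem_reverse] at hB
    have hsup : ∀ z, z ∈ q.support ∨ z ∈ r.support → z ∈ p.support := by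
      intro z hz
      rw [← Walk.mem_support_rotate_iff p x hx, ← hcdef, ← hspec, Walk.mem_support_append_iff]
      exact hz
    have hedge : u ∈ p.support → v ∈ p.support → s(u, v) ∈ q.edges ∨ s(u, v) ∈ r.edges := by
      intro h1 h2
      have h3 := hch u h1 v h2 huv
      rw [← (p.rotate_edges x hx).mem_iff, ← hcdef, ← hspec, Walk.edges_append,
        List.mem_append] at h3
      exact h3
    have hfin : u ∈ p.support → v ∈ p.support → (u ∈ q.support ∧ v ∈ q.support) ∨
        (u ∈ r.support ∧ v ∈ r.support) := by
      intro h1 h2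
      rcases hedge h1 h2 with h | h
      · exact Or.inl ⟨q.fst_mem_support_of_mem_edges h, q.snd_mem_support_of_mem_edges h⟩
      · exact Or.inr ⟨r.fst_mem_support_of_mem_edges h, r.snd_mem_support_of_mem_edges h⟩
    have hu' := hdis u hux huy
    have hv' := hdis v hvx hvy
    have hboth : u ∈ p.support ∧ v ∈ p.support := by
      rcases hA with h | h <;> rcases hB with h' | h'
      · exact (hu' h h').elim
      · exact ⟨hsup u (Or.inl h), hsup v (Or.inr h')⟩
      · exact ⟨hsup u (Or.inr h'), hsup v (Or.inl h)⟩
      · exact (hv' h h').elim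
    rcases hfin hboth.1 hboth.2 with h | h
    · rcases hB with h' | h'
      · exact hu' h.1 h'
      · exact hv' h.2 h'
    · rcases hA with h' | h'
      · exact hu' h' h.1
      · exact hv' h' h.2
  · intro v hv
    have hv : v ∈ p.support := hv
    have hc := hp.rotate hv
    have h1 := (p.rotate v hv).adj_snd hc.not_nil
    have h2 := ((p.rotate v hv).adj_penultimate hc.not_nil).symm
    have hne := hc.snd_ne_penultimate
    have hs1 : (p.rotate v hv).snd ∈ p.support := by
      rw [← Walk.mem_support_rotate_iff p v hv]; exact Walk.getVert_mem_support _ _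
    have hs2 : (p.rotate v hv).penultimate ∈ p.support := by
      rw [← Walk.mem_support_rotate_iff p v hv]; exact Walk.getVert_mem_support _ _
    rcases lt_or_gt_of_ne (fun e => hne (hinj e)) with h | h
    · exact ⟨_, hs1, _, hs2, h, h1, h2⟩
    · exact ⟨_, hs2, _, hs1, h, h2, h1⟩

/-! ### Geodesics give faces -/

theorem geodesic_chord {H : SimpleGraph V} {a b : V} (p : H.Walk a b) (hp : p.length = H.dist a b)
    {x y : V} (hx : x ∈ p.support) (hy : y ∈ p.support) (hxy : H.Adj x y) :
    s(x, y) ∈ p.edges := by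
  obtain ⟨i, rfl, hi⟩ := Walk.mem_support_iff_exists_getVert.mp hx
  obtain ⟨j, rfl, hj⟩ := Walk.mem_support_iff_exists_getVert.mp hy
  have key : ∀ i j, i ≤ p.length → j ≤ p.length → i ≤ j → H.Adj (p.getVert i) (p.getVert j) →
      s(p.getVert i, p.getVert j) ∈ p.edges := by
    intro i j hi hj hij hadj
    have h1 := H.dist_le ((p.take i).append (Walk.cons hadj (p.drop j)))
    simp only [Walk.length_append, Walk.length_cons, Walk.take_length, Walk.drop_length] at h1
    rw [min_eq_left hi] at h1
    have hne : i ≠ j := by rintro rfl; exact hadj.ne rfl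
    have hj' : j = i + 1 := by omega
    rw [Walk.mk_mem_edges_iff_exists]
    exact ⟨i, by omega, by rw [hj']⟩
  rcases le_total i j with h | h
  · exact key i j hi hj h hxy
  · rw [Sym2.eq_swap]; exact key j i hj hi h hxy.symm

/-- `G` restricted to `U ∪ {a, b}` without the edge `ab`. -/
def side (G : SimpleGraph V) (U : Set V) (a b : V) : SimpleGraph V where
  Adj x y := G.Adj x y ∧ (x ∈ U ∨ x = a ∨ x = b) ∧ (y ∈ U ∨ y = a ∨ y = b) ∧ s(x, y) ≠ s(a, b)
  symm := ⟨fun x y h => ⟨h.1.symm, h.2.2.1, h.2.1, by rw [Sym2.eq_swap]; exact h.2.2.2⟩⟩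
  loopless := ⟨fun x h => h.1.ne rfl⟩

theorem side_reach {U : Set V} {a b c : V} (hb : ∀ x ∈ U, x ≠ a ∧ x ≠ b)
    (hU : ∀ x ∈ U, ∀ y, G.Adj x y → y ∈ U ∨ y = a ∨ y = b) {e : V} (he : e = a ∨ e = b)
    (hc : c = a ∨ c = b) (hec : e ≠ c)
    {x y : {u : V | u ≠ c}} (q : (G.induce {u : V | u ≠ c}).Walk x y) (hy : y.1 = e)
    (hx : x.1 ∈ U ∨ x.1 = e) : (side G U a b).Reachable x.1 e := by
  induction q with
  | nil => rw [hy]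
  | @cons x z y h q ih =>
    rcases hx with hx | hx
    · have hadj : G.Adj x.1 z.1 := h
      have hz := hU x.1 hx z.1 hadj
      have hzc : z.1 ≠ c := z.2
      have h1 := hb x.1 hx
      have hs : (side G U a b).Adj x.1 z.1 := by
        refine ⟨hadj, Or.inl hx, hz, ?_⟩
        intro h
        rw [Sym2.eq_iff] at h
        tauto
      refine hs.reachable.trans (ih hy ?_)
      rcases hz with hz | hz | hz
      · exact Or.inl hz
      · right
        rcases he with he | he <;> rcases hc with hc | hc <;> simp_all
      · right
        rcases he with he | he <;> rcases hc with hc | hc <;> simp_all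
    · rw [hx]

theorem exists_cycle (hconn : G.Connected) (hcut : ∀ v, ¬ IsCutvertex G v) {U : Set V} {a b d : V}
    (hab : G.Adj a b) (hb : ∀ x ∈ U, x ≠ a ∧ x ≠ b)
    (hU : ∀ x ∈ U, ∀ y, G.Adj x y → y ∈ U ∨ y = a ∨ y = b) (hd : d ∈ U) :
    ∃ (w : V) (p : G.Walk w w), p.IsCycle ∧ Chordless G p ∧ s(a, b) ∈ p.edges ∧
      ∀ x ∈ p.support, x ∈ U ∨ x = a ∨ x = b := by
  have reach : ∀ e c, (e = a ∨ e = b) → (c = a ∨ c = b) → e ≠ c →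
      (side G U a b).Reachable d e := by
    intro e c he hc hec
    have hdc : d ≠ c := by rcases hc with rfl | rfl; exacts [(hb d hd).1, (hb d hd).2]
    have hr : (G.induce {u : V | u ≠ c}).Reachable ⟨d, hdc⟩ ⟨e, hec⟩ := by
      by_contra hn
      exact hcut c ⟨⟨d, hdc⟩, ⟨e, hec⟩, hconn.preconnected _ _, hn⟩
    obtain ⟨q⟩ := hr
    exact side_reach hb hU he hc hec q rfl (Or.inl hd)
  have hr : (side G U a b).Reachable a b :=
    (reach a b (Or.inl rfl) (Or.inr rfl) hab.ne).symm.trans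
      (reach b a (Or.inr rfl) (Or.inl rfl) hab.ne.symm)
  obtain ⟨p, hpath, hlen⟩ := hr.exists_path_of_dist
  have hle : side G U a b ≤ G := fun x y h => h.1
  have hmem : ∀ x ∈ p.support, x ∈ U ∨ x = a ∨ x = b := by
    intro x hx
    rw [Walk.mem_support_iff_exists_mem_edges_of_not_nil (Walk.not_nil_of_ne hab.ne)] at hx
    obtain ⟨e, he, hxe⟩ := hx
    have he' := p.edges_subset_edgeSet he
    obtain ⟨y, rfl⟩ := hxe
    exact (show (side G U a b).Adj x y from he').2.1
  refine ⟨b, Walk.cons hab.symm (p.mapLe hle), ?_, ?_, ?_, ?_⟩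
  · rw [Walk.cons_isCycle_iff]
    refine ⟨hpath.mapLe hle, fun h => ?_⟩
    rw [Walk.edges_mapLe_eq_edges] at h
    exact (show (side G U a b).Adj b a from p.edges_subset_edgeSet h).2.2.2 Sym2.eq_swap
  · intro x hx y hy hxy
    have hx' : x ∈ p.support := by
      rw [Walk.support_cons, List.mem_cons, Walk.support_mapLe_eq_support] at hx
      rcases hx with rfl | hx
      · exact p.end_mem_support
      · exact hx
    have hy' : y ∈ p.support := by
      rw [Walk.support_cons, List.mem_cons, Walk.support_mapLe_eq_support] at hy
      rcases hy with rfl | hy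
      · exact p.end_mem_support
      · exact hy
    rw [Walk.edges_cons, List.mem_cons, Walk.edges_mapLe_eq_edges]
    by_cases hs : s(x, y) = s(a, b)
    · left; rw [hs]; exact Sym2.eq_swap
    · right
      exact geodesic_chord p hlen hx' hy' ⟨hxy, hmem x hx', hmem y hy', hs⟩
  · simp [Sym2.eq_swap]
  · intro x hx
    rw [Walk.support_cons, List.mem_cons, Walk.support_mapLe_eq_support] at hx
    rcases hx with rfl | hx
    · simp
    · exact hmem x hx

/-! ### Ranked graphs -/

theorem acyclic_of_rank {X : Type*} (H : SimpleGraph X) (r : X → ℝ)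
    (h1 : ∀ x y, H.Adj x y → r x ≠ r y)
    (h2 : ∀ x y z, H.Adj x y → H.Adj x z → r x < r y → r x < r z → y = z) : H.IsAcyclic := by
  classical
  intro v p hp
  obtain ⟨x, hx, hmin⟩ := Set.exists_min_image {x | x ∈ p.support} r
    (List.finite_toSet _) ⟨v, p.start_mem_support⟩
  have hx : x ∈ p.support := hx
  have hc := hp.rotate hx
  have ha1 := (p.rotate x hx).adj_snd hc.not_nil
  have ha2 := ((p.rotate x hx).adj_penultimate hc.not_nil).symm
  have hs1 : (p.rotate x hx).snd ∈ p.support := by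
    rw [← Walk.mem_support_rotate_iff p x hx]; exact Walk.getVert_mem_support _ _
  have hs2 : (p.rotate x hx).penultimate ∈ p.support := by
    rw [← Walk.mem_support_rotate_iff p x hx]; exact Walk.getVert_mem_support _ _
  exact hc.snd_ne_penultimate (h2 x _ _ ha1 ha2 (lt_of_le_of_ne (hmin _ hs1) (h1 _ _ ha1))
    (lt_of_le_of_ne (hmin _ hs2) (h1 _ _ ha2)))

/-- The vertices of a set of edges. -/
def vset (s : Finset (Sym2 V)) : Set V := {x | ∃ e ∈ s, x ∈ e}

theorem vset_cycle [DecidableEq V] {w : V} (p : G.Walk w w) (hp : p.IsCycle) :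
    vset p.edges.toFinset = {x | x ∈ p.support} := by
  ext x
  simp [vset, Walk.mem_support_iff_exists_mem_edges_of_not_nil hp.not_nil]

theorem mem_face [DecidableEq V] {s : Finset (Sym2 V)} (hs : s ∈ basicCycles G) (a b : V) :
    s(a, b) ∈ s ↔ G.Adj a b ∧ a ∈ vset s ∧ b ∈ vset s := by
  obtain ⟨w, p, hp, hch, rfl⟩ := hs
  constructor
  · intro h
    refine ⟨p.edges_subset_edgeSet (List.mem_toFinset.mp h), ⟨_, h, by simp⟩, ⟨_, h, by simp⟩⟩
  · rintro ⟨h, ha, hb⟩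
    rw [vset_cycle p hp] at ha hb
    exact List.mem_toFinset.mpr (hch a ha b hb h)

theorem face_ext [DecidableEq V] {s t : basicCycles G} (h : vset s.1 = vset t.1) : s = t := by
  apply Subtype.ext
  ext e
  induction e with
  | _ a b => rw [mem_face s.2, mem_face t.2, h]

theorem face_isF [DecidableEq V] (nc : ∀ a b c d, G.Adj a b → G.Adj c d → f a < f c → f c < f b →
    f b < f d → False) (hinj : Function.Injective f) (s : basicCycles G) :
    IsF G f (vset s.1) := by
  obtain ⟨s, w, p, hp, hch, rfl⟩ := s
  simp only [vset_cycle p hp]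
  exact cycle_isF nc hinj p hp hch

theorem dual_adj [DecidableEq V] (hinj : Function.Injective f) {s t : basicCycles G} :
    (weakDual G).Adj s t ↔ s ≠ t ∧ ∃ a b, G.Adj a b ∧ f a < f b ∧ a ∈ vset s.1 ∧ b ∈ vset s.1 ∧
      a ∈ vset t.1 ∧ b ∈ vset t.1 := by
  have aux : (s.1 ∩ t.1 : Finset (Sym2 V)).Nonempty ↔ ∃ a b, G.Adj a b ∧ f a < f b ∧
      a ∈ vset s.1 ∧ b ∈ vset s.1 ∧ a ∈ vset t.1 ∧ b ∈ vset t.1 := by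
    constructor
    · rintro ⟨e, he⟩
      rw [Finset.mem_inter] at he
      induction e with
      | _ a b =>
        rw [mem_face s.2, mem_face t.2] at he
        obtain ⟨⟨h, h1, h2⟩, -, h3, h4⟩ := he
        rcases lt_or_gt_of_ne (fun e => h.ne (hinj e)) with hl | hl
        · exact ⟨a, b, h, hl, h1, h2, h3, h4⟩
        · exact ⟨b, a, h.symm, hl, h2, h1, h4, h3⟩
    · rintro ⟨a, b, h, -, h1, h2, h3, h4⟩
      refine ⟨s(a, b), ?_⟩
      rw [Finset.mem_inter, mem_face s.2, mem_face t.2]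
      exact ⟨⟨h, h1, h2⟩, h, h3, h4⟩
  rw [← aux]
  simp only [weakDual, SimpleGraph.fromRel_adj]
  rw [Finset.inter_comm t.1 s.1, or_self]

end WD

/-- The weak dual of an outerplanar graph is a forest; the weak dual of a biconnected
outerplanar graph is a tree. -/
theorem weakDual_outerplanar_isForest_isTree
    {V : Type*} [Fintype V] [DecidableEq V] (G : SimpleGraph V)
    (hop : Outerplanar G) :
    (weakDual G).IsAcyclic ∧
      (G.Connected → 3 ≤ Fintype.card V → (∀ v, ¬ IsCutvertex G v) →
        (weakDual G).IsTree) := by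
  classical
  obtain ⟨⟨f, hinj⟩, hf⟩ := hop
  have nc : ∀ a b c d, G.Adj a b → G.Adj c d → f a < f c → f c < f b → f b < f d → False := by
    intro a b c d hab hcd h1 h2 h3
    refine hf a b c d hab hcd ?_ ?_ ?_ ?_ ?_
    · rintro rfl; exact lt_irrefl _ h1
    · rintro rfl; linarith
    · rintro rfl; exact lt_irrefl _ h2
    · rintro rfl; exact lt_irrefl _ h3
    · left
      simp only [Function.Embedding.coeFn_mk]
      rw [min_eq_left (by linarith), min_eq_left (by linarith), max_eq_right (by linarith),
        max_eq_right (by linarith)]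
      exact ⟨h1, h2, h3⟩
  have hF : ∀ s : basicCycles G, WD.IsF G f (WD.vset s.1) := WD.face_isF nc hinj
  choose m hm M hM hmM hlt htop using fun s => (hF s).top
  -- a common edge that is a lower edge of `s`
  have hbot : ∀ s a b, a ∈ WD.vset s.1 → b ∈ WD.vset s.1 → f a < f b →
      (∀ x ∈ WD.vset s.1, ¬ (f a < f x ∧ f x < f b)) → f b - f a < f (M s) - f (m s) := by
    intro s a b ha hb hab h
    have h1 := htop s a ha
    have h2 := htop s b hb
    by_contra hc
    have e1 : f a = f (m s) := by linarith
    have e2 : f b = f (M s) := by linarith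
    exact (hF s).third h (fun z hz => by rw [e1, e2]; exact htop s z hz) hab
  have htp : ∀ s a b, a ∈ WD.vset s.1 → b ∈ WD.vset s.1 →
      (∀ x ∈ WD.vset s.1, f a ≤ f x ∧ f x ≤ f b) → a = m s ∧ b = M s := by
    intro s a b ha hb h
    exact ⟨hinj (le_antisymm (h _ (hm s)).1 (htop s a ha).1),
      hinj (le_antisymm (htop s b hb).2 (h _ (hM s)).2)⟩
  have htt : ∀ s t : basicCycles G, m s = m t → M s = M t → s = t := by
    intro s t h1 h2
    apply WD.face_ext
    apply Set.Subset.antisymm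
    · exact WD.top_sub (hF t) (hF s) (hm t) (hM t) (h1 ▸ hm s) (h2 ▸ hM s) (htop t)
        (h1 ▸ h2 ▸ htop s)
    · exact WD.top_sub (hF s) (hF t) (hm s) (hM s) (h1 ▸ hm t) (h2 ▸ hM t) (htop s)
        (h1 ▸ h2 ▸ htop t)
  have hbb : ∀ (s t : basicCycles G) a b, f a < f b → a ∈ WD.vset s.1 → b ∈ WD.vset s.1 →
      a ∈ WD.vset t.1 → b ∈ WD.vset t.1 → (∀ x ∈ WD.vset s.1, ¬ (f a < f x ∧ f x < f b)) →
      (∀ x ∈ WD.vset t.1, ¬ (f a < f x ∧ f x < f b)) → s = t := by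
    intro s t a b hab h1 h2 h3 h4 h5 h6
    apply WD.face_ext
    exact Set.Subset.antisymm (WD.bot_sub (hF t) (hF s) hab h3 h4 h1 h2 h6 h5)
      (WD.bot_sub (hF s) (hF t) hab h1 h2 h3 h4 h5 h6)
  -- adjacency means that one face is the parent of the other
  have hpar : ∀ s t : basicCycles G, (weakDual G).Adj s t →
      (f (M s) - f (m s) < f (M t) - f (m t) ∧ m s ∈ WD.vset t.1 ∧ M s ∈ WD.vset t.1 ∧
        ∀ x ∈ WD.vset t.1, ¬ (f (m s) < f x ∧ f x < f (M s))) ∨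
      f (M t) - f (m t) < f (M s) - f (m s) := by
    intro s t hst
    obtain ⟨hne, a, b, hadj, hab, h1, h2, h3, h4⟩ := (WD.dual_adj hinj).mp hst
    rcases (hF s).lam a b hadj hab with hs | hs <;> rcases (hF t).lam a b hadj hab with ht | ht
    · exact absurd (hbb s t a b hab h1 h2 h3 h4 hs ht) hne
    · right
      obtain ⟨e1, e2⟩ := htp t a b h3 h4 ht
      rw [← e1, ← e2]
      exact hbot s a b h1 h2 hab hs
    · left
      obtain ⟨e1, e2⟩ := htp s a b h1 h2 hs
      rw [← e1, ← e2]
      exact ⟨hbot t a b h3 h4 hab ht, h3, h4, ht⟩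
    · obtain ⟨e1, e2⟩ := htp s a b h1 h2 hs
      obtain ⟨e3, e4⟩ := htp t a b h3 h4 ht
      exact absurd (htt s t (e1.symm.trans e3) (e2.symm.trans e4)) hne
  have hacyc : (weakDual G).IsAcyclic := by
    refine WD.acyclic_of_rank _ (fun s => f (M s) - f (m s)) ?_ ?_
    · intro s t hst h
      rcases hpar s t hst with h' | h'
      · linarith [h'.1]
      · linarith
    · intro s t u hst hsu h1 h2
      rcases hpar s t hst with h3 | h3
      · rcases hpar s u hsu with h4 | h4
        · exact hbb t u (m s) (M s) (hlt s) h3.2.1 h3.2.2.1 h4.2.1 h4.2.2.1 h3.2.2.2 h4.2.2.2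
        · linarith
      · linarith
  refine ⟨hacyc, fun hconn hcard hcut => ⟨?_, hacyc⟩⟩
  -- a face with a vertex outside its span has a parent
  have hup : ∀ (s : basicCycles G) d, ¬ (f (m s) ≤ f d ∧ f d ≤ f (M s)) →
      ∃ t, (weakDual G).Adj s t ∧ f (M s) - f (m s) < f (M t) - f (m t) := by
    intro s d hd
    obtain ⟨w, p, hp, hch, he, hsup⟩ := WD.exists_cycle hconn hcut
      (U := {x | ¬ (f (m s) ≤ f x ∧ f x ≤ f (M s))}) (hmM s)
      (by
        rintro x hx
        refine ⟨?_, ?_⟩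
        · rintro rfl; exact hx ⟨le_rfl, (hlt s).le⟩
        · rintro rfl; exact hx ⟨(hlt s).le, le_rfl⟩)
      (by
        intro x hx y hxy
        by_contra hc
        simp only [Set.mem_ofPred_eq, not_or, not_not] at hc
        obtain ⟨⟨h1, h2⟩, h3, h4⟩ := hc
        have h1' := lt_of_le_of_ne h1 (fun e => h3 (hinj e).symm)
        have h2' := lt_of_le_of_ne h2 (fun e => h4 (hinj e))
        have hx' : f x < f (m s) ∨ f (M s) < f x := by
          by_contra hc
          push Not at hc
          exact hx hc
        rcases hx' with h | h
        · exact nc x y (m s) (M s) hxy (hmM s) h h1' h2'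
        · exact nc (m s) (M s) y x (hmM s) hxy.symm h1' h2' h)
      hd
    let t : basicCycles G := ⟨p.edges.toFinset, w, p, hp, hch, rfl⟩
    have hvt : WD.vset t.1 = {x | x ∈ p.support} := WD.vset_cycle p hp
    have h1 : m s ∈ WD.vset t.1 := by rw [hvt]; exact p.fst_mem_support_of_mem_edges he
    have h2 : M s ∈ WD.vset t.1 := by rw [hvt]; exact p.snd_mem_support_of_mem_edges he
    have hb : ∀ x ∈ WD.vset t.1, ¬ (f (m s) < f x ∧ f x < f (M s)) := by
      intro x hx h
      rw [hvt] at hx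
      rcases hsup x hx with h' | h' | h'
      · exact h' ⟨h.1.le, h.2.le⟩
      · rw [h'] at h; exact lt_irrefl _ h.1
      · rw [h'] at h; exact lt_irrefl _ h.2
    have hr := hbot t _ _ h1 h2 (hlt s) hb
    refine ⟨t, (WD.dual_adj hinj).mpr ⟨?_, m s, M s, hmM s, hlt s, hm s, hM s, h1, h2⟩, hr⟩
    intro e
    rw [← e] at hr
    exact lt_irrefl _ hr
  have hfin : Finite (basicCycles G) := inferInstance
  have hroot : ∀ s : basicCycles G, ∃ t, (weakDual G).Reachable s t ∧
      ∀ d, f (m t) ≤ f d ∧ f d ≤ f (M t) := by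
    intro s
    obtain ⟨t, ht, hmax⟩ := Set.exists_max_image {t | (weakDual G).Reachable s t}
      (fun t => f (M t) - f (m t)) (Set.toFinite _) ⟨s, SimpleGraph.Reachable.refl s⟩
    refine ⟨t, ht, fun d => ?_⟩
    by_contra hd
    obtain ⟨u, hu, hlt'⟩ := hup t d hd
    have := hmax u (SimpleGraph.Reachable.trans ht hu.reachable)
    linarith
  have hne : Nonempty (basicCycles G) := by
    have : Nontrivial V := Fintype.one_lt_card_iff_nontrivial.mp (by omega)
    obtain ⟨a⟩ := hconn.nonempty
    obtain ⟨b, hab⟩ := hconn.preconnected.exists_adj_of_nontrivial a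
    obtain ⟨d, hda, hdb⟩ : ∃ d, d ≠ a ∧ d ≠ b := by
      by_contra hc
      push Not at hc
      have : (Finset.univ : Finset V) ⊆ {a, b} := by
        intro x _
        by_cases hx : x = a
        · simp [hx]
        · simp [hc x hx]
      have h1 := Finset.card_le_card this
      have h2 : ({a, b} : Finset V).card ≤ 2 := Finset.card_le_two
      rw [Finset.card_univ] at h1
      omega
    obtain ⟨w, p, hp, hch, -, -⟩ := WD.exists_cycle hconn hcut (U := {x | x ≠ a ∧ x ≠ b}) hab
      (fun x hx => hx) (fun x _ y _ => by
        by_cases h1 : y = a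
        · simp [h1]
        · by_cases h2 : y = b
          · simp [h2]
          · left; exact ⟨h1, h2⟩) (d := d) ⟨hda, hdb⟩
    exact ⟨⟨p.edges.toFinset, w, p, hp, hch, rfl⟩⟩
  refine ⟨fun s t => ?_⟩
  obtain ⟨s', hs, hs'⟩ := hroot s
  obtain ⟨t', ht, ht'⟩ := hroot t
  have : s' = t' := htt s' t' (hinj (le_antisymm (hs' _).1 (ht' _).1))
    (hinj (le_antisymm (ht' _).2 (hs' _).2))
  exact hs.trans (this ▸ ht.symm)
end
end
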